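/- arXiv:2307.11504 — 5 statements merged into one kernel-verified Lean document; each statement's English description precedes it below -/
import Mathlib

section
/- For every C < ∞ and every θ ∈ (0,1) there exist constants T₁ = T₁(C,θ) < ∞, s₁ = s₁(C,θ) < ∞, and α = α(C,θ) ∈ (0,1) with the following property. Let u be a smooth spacelike solution of the graphical mean curvature flow equation on the unit ball B₁ ⊂ ℝ³ for s ∈ [0,∞), with H ≥ 0, and such that u(x,s) ≥ T₁ and v(x,s) ≤ C at every point (x,s) with e^{α u(x,s)}|x|² ≤ 1. Then for every s ≥ s₁ and every x with e^{α u(x,s)}|x|² ≤ θ, one has v(x,s) ≤ 1 + θ. -/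
/- Common definitions: spacelike graphs in de Sitter space ℝ³ × ℝ with metric
   g = e^{2t}(dx₁² + dx₂² + dx₃²) − dt², in graph coordinates. -/

noncomputable section

open Real Filter

/-- Spatial tslice ℝ³, modeled as `Fin 3 → ℝ`. -/
abbrev V3 : Type := Fin 3 → ℝ

/-- First spatial partial derivative `∂_i f`. -/
def pd (f : V3 → ℝ) (x : V3) (i : Fin 3) : ℝ :=
  fderiv ℝ f x (Pi.single i 1)

/-- Second spatial partial derivative `∂_i ∂_j f`. -/
def pd2 (f : V3 → ℝ) (x : V3) (i j : Fin 3) : ℝ :=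
  pd (fun y => pd f y j) x i

/-- Kronecker delta `δ_{ij}`. -/
def kd (i j : Fin 3) : ℝ := if i = j then (1 : ℝ) else 0

/-- `w = 1 − e^{−2u} |Du|²`. -/
def wfun (u : V3 → ℝ) (x : V3) : ℝ :=
  1 - exp (-2 * u x) * ∑ i, (pd u x i) ^ 2

/-- The spacelike condition `e^{−2u} |Du|² < 1` for the graph of `u`. -/
def Spacelike (u : V3 → ℝ) (x : V3) : Prop :=
  exp (-2 * u x) * ∑ i, (pd u x i) ^ 2 < 1

/-- The gradient function `v = w^{−1/2}`. -/
def gradFun (u : V3 → ℝ) (x : V3) : ℝ := (Real.sqrt (wfun u x))⁻¹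

/-- Induced metric `h_{ij} = e^{2u} δ_{ij} − u_i u_j`. -/
def hmet (u : V3 → ℝ) (x : V3) (i j : Fin 3) : ℝ :=
  exp (2 * u x) * kd i j - pd u x i * pd u x j

/-- Inverse induced metric `h^{ij} = e^{−2u} (δ_{ij} + e^{−2u} u_i u_j / w)`. -/
def hInv (u : V3 → ℝ) (x : V3) (i j : Fin 3) : ℝ :=
  exp (-2 * u x) * (kd i j + exp (-2 * u x) * pd u x i * pd u x j / wfun u x)

/-- Second fundamental form `a_{ij} = v (u_{ij} + e^{2u} δ_{ij} − 2 u_i u_j)`. -/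
def sff (u : V3 → ℝ) (x : V3) (i j : Fin 3) : ℝ :=
  gradFun u x * (pd2 u x i j + exp (2 * u x) * kd i j - 2 * pd u x i * pd u x j)

/-- Mean curvature `H = h^{ij} a_{ij}`. -/
def mcH (u : V3 → ℝ) (x : V3) : ℝ := ∑ i, ∑ j, hInv u x i j * sff u x i j

/-- Squared norm of the second fundamental form `|A|² = h^{ik} h^{jl} a_{ij} a_{kl}`. -/
def normA2 (u : V3 → ℝ) (x : V3) : ℝ :=
  ∑ i, ∑ j, ∑ k, ∑ l, hInv u x i k * hInv u x j l * sff u x i j * sff u x k l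

/-- Intrinsic inner product of gradients `⟨∇_M f, ∇_M φ⟩ = h^{ij} ∂_i f ∂_j φ`. -/
def gradPair (u f φ : V3 → ℝ) (x : V3) : ℝ :=
  ∑ i, ∑ j, hInv u x i j * pd f x i * pd φ x j

/-- Squared intrinsic gradient `|∇_M f|² = h^{ij} ∂_i f ∂_j f`. -/
def gradSq (u f : V3 → ℝ) (x : V3) : ℝ := gradPair u f f x

/-- Determinant of the induced metric. -/
def detH (u : V3 → ℝ) (x : V3) : ℝ := Matrix.det (Matrix.of fun i j => hmet u x i j)

/-- Laplace–Beltrami operator of the induced metric: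
`Δ_M f = (det h)^{−1/2} ∂_i ((det h)^{1/2} h^{ij} ∂_j f)`. -/
def lapM (u f : V3 → ℝ) (x : V3) : ℝ :=
  (Real.sqrt (detH u x))⁻¹ *
    ∑ i, pd (fun y => Real.sqrt (detH u y) * ∑ j, hInv u y i j * pd f y j) x i

/-- Time tslice of a time-dependent family. -/
def tslice (u : V3 → ℝ → ℝ) (s : ℝ) : V3 → ℝ := fun x => u x s

/-- The graphical mean curvature flow equation
`∂_s u = h^{ij} (u_{ij} + e^{2u} δ_{ij} − 2 u_i u_j)` at the point `(x, s)`. -/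
def FlowEq (u : V3 → ℝ → ℝ) (x : V3) (s : ℝ) : Prop :=
  deriv (fun r => u x r) s =
    ∑ i, ∑ j, hInv (tslice u s) x i j *
      (pd2 (tslice u s) x i j + exp (2 * u x s) * kd i j
        - 2 * pd (tslice u s) x i * pd (tslice u s) x j)

/-- Heat operator along normal trajectories:
`(∂_s − Δ) Q = ∂_s Q + H v e^{−2u} u_k ∂_k Q − Δ_M Q`. -/
def heatOp (u : V3 → ℝ → ℝ) (Q : V3 → ℝ → ℝ) (x : V3) (s : ℝ) : ℝ :=
  deriv (fun r => Q x r) s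
    + mcH (tslice u s) x * gradFun (tslice u s) x * exp (-2 * u x s) *
        (∑ k, pd (tslice u s) x k * pd (fun y => Q y s) x k)
    - lapM (tslice u s) (fun y => Q y s) x

/-- Components `P^k = h^{kj} u_j` (minus the components of `∂_t^⊤`). -/
def Pvec (u : V3 → ℝ) (x : V3) (k : Fin 3) : ℝ := ∑ j, hInv u x k j * pd u x j

/-- `A(∂_t^⊤, ∂_t^⊤) = a_{kl} P^k P^l`. -/
def Att (u : V3 → ℝ) (x : V3) : ℝ :=
  ∑ k, ∑ l, sff u x k l * Pvec u x k * Pvec u x l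

/-- `|A(·, ∂_t^⊤)|² = h^{mn} a_{mk} P^k a_{nl} P^l`. -/
def At2 (u : V3 → ℝ) (x : V3) : ℝ :=
  ∑ m, ∑ n, hInv u x m n * (∑ k, sff u x m k * Pvec u x k) *
    (∑ l, sff u x n l * Pvec u x l)

end


section General

open Real Filter Topology

/-- Space-time. -/
abbrev E4 : Type := V3 × ℝ

/-- Directional derivative. -/
noncomputable def dd (e : E4) (F : E4 → ℝ) (p : E4) : ℝ := fderiv ℝ F p e

/-- Smoothness on a set. -/
def Sm (O : Set E4) (F : E4 → ℝ) : Prop := ContDiffOn ℝ (⊤ : ℕ∞) F O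

/-- Spatial basis vectors. -/
noncomputable def eb (i : Fin 3) : E4 := (Pi.single i 1, 0)

/-- Time basis vector. -/
noncomputable def et : E4 := (0, 1)

/-- Spatial vectors. -/
noncomputable def sv (c : V3) : E4 := (c, 0)

lemma Sm.diff {O : Set E4} (hO : IsOpen O) {F : E4 → ℝ} (hF : Sm O F) {p : E4} (hp : p ∈ O) :
    DifferentiableAt ℝ F p :=
  (hF.contDiffAt (hO.mem_nhds hp)).differentiableAt (by simp)

lemma Sm.dd {O : Set E4} (hO : IsOpen O) {F : E4 → ℝ} (hF : Sm O F) (e : E4) :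
    Sm O (dd e F) := by
  have h : ContDiffOn ℝ (⊤ : ℕ∞) (fderiv ℝ F) O := hF.fderiv_of_isOpen hO (by simp)
  exact h.clm_apply contDiffOn_const

lemma dd_comm {O : Set E4} (hO : IsOpen O) {F : E4 → ℝ} (hF : Sm O F) {p : E4} (hp : p ∈ O)
    (e f : E4) : dd e (dd f F) p = dd f (dd e F) p := by
  have hc : ContDiffAt ℝ (⊤ : ℕ∞) F p := hF.contDiffAt (hO.mem_nhds hp)
  have hs : IsSymmSndFDerivAt ℝ F p := by
    apply hc.isSymmSndFDerivAt
    simp only [minSmoothness_of_isRCLikeNormedField]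
    exact WithTop.coe_le_coe.mpr (le_top : (2 : ℕ∞) ≤ ⊤)
  have hd : DifferentiableAt ℝ (fderiv ℝ F) p := by
    have h : ContDiffOn ℝ (⊤ : ℕ∞) (fderiv ℝ F) O := hF.fderiv_of_isOpen hO (by simp)
    exact (h.contDiffAt (hO.mem_nhds hp)).differentiableAt (by simp)
  have key : ∀ a b : E4, dd a (dd b F) p = fderiv ℝ (fderiv ℝ F) p a b := by
    intro a b
    unfold dd
    rw [fderiv_clm_apply hd (differentiableAt_const b)]
    simp
  rw [key, key]
  exact hs e f

lemma dd_congr {O : Set E4} (hO : IsOpen O) {F G : E4 → ℝ} (h : ∀ p ∈ O, F p = G p) {p : E4}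
    (hp : p ∈ O) (e : E4) : dd e F p = dd e G p := by
  unfold dd
  rw [Filter.EventuallyEq.fderiv_eq]
  filter_upwards [hO.mem_nhds hp] with q hq using h q hq

lemma dd_add {F G : E4 → ℝ} {p : E4} (hF : DifferentiableAt ℝ F p) (hG : DifferentiableAt ℝ G p)
    (e : E4) : dd e (fun p => F p + G p) p = dd e F p + dd e G p := by
  unfold dd; rw [fderiv_fun_add hF hG]; simp

lemma dd_sub {F G : E4 → ℝ} {p : E4} (hF : DifferentiableAt ℝ F p) (hG : DifferentiableAt ℝ G p)
    (e : E4) : dd e (fun p => F p - G p) p = dd e F p - dd e G p := by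
  unfold dd; rw [fderiv_fun_sub hF hG]; simp

lemma dd_mul {F G : E4 → ℝ} {p : E4} (hF : DifferentiableAt ℝ F p) (hG : DifferentiableAt ℝ G p)
    (e : E4) : dd e (fun p => F p * G p) p = dd e F p * G p + F p * dd e G p := by
  unfold dd; rw [fderiv_fun_mul hF hG]; simp; ring

lemma dd_const (c : ℝ) (p e : E4) : dd e (fun _ => c) p = 0 := by
  unfold dd; simp

lemma dd_cmul {F : E4 → ℝ} {p : E4} (hF : DifferentiableAt ℝ F p) (c : ℝ)
    (e : E4) : dd e (fun p => c * F p) p = c * dd e F p := by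
  rw [dd_mul (differentiableAt_const c) hF, dd_const]; ring

lemma dd_sum {F : Fin 3 → E4 → ℝ} {p : E4} (hF : ∀ i, DifferentiableAt ℝ (F i) p) (e : E4) :
    dd e (fun p => ∑ i, F i p) p = ∑ i, dd e (F i) p := by
  unfold dd; rw [fderiv_fun_sum (fun i _ => hF i)]; simp

lemma dd_pow {F : E4 → ℝ} {p : E4} (hF : DifferentiableAt ℝ F p) (n : ℕ) (e : E4) :
    dd e (fun p => F p ^ (n + 1)) p = (n + 1) * F p ^ n * dd e F p := by
  unfold dd; rw [fderiv_fun_pow _ hF]; simp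

lemma dd_exp {F : E4 → ℝ} {p : E4} (hF : DifferentiableAt ℝ F p) (e : E4) :
    dd e (fun p => exp (F p)) p = exp (F p) * dd e F p := by
  unfold dd; rw [fderiv_exp hF]; simp

lemma dd_coord (i : Fin 3) (p e : E4) : dd e (fun p : E4 => p.1 i) p = e.1 i := by
  unfold dd
  have : HasFDerivAt (fun p : E4 => p.1 i)
      ((ContinuousLinearMap.proj (R := ℝ) (φ := fun _ : Fin 3 => ℝ) i).comp
        (ContinuousLinearMap.fst ℝ V3 ℝ)) p :=
    ((ContinuousLinearMap.proj (R := ℝ) (φ := fun _ : Fin 3 => ℝ) i).comp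
        (ContinuousLinearMap.fst ℝ V3 ℝ)).hasFDerivAt
  rw [this.fderiv]; simp

lemma dd_time (p e : E4) : dd e (fun p : E4 => p.2) p = e.2 := by
  unfold dd
  rw [show (fun p : E4 => p.2) = (ContinuousLinearMap.snd ℝ V3 ℝ) from rfl,
    ContinuousLinearMap.fderiv]; simp

lemma sv_eq (c : V3) : sv c = ∑ i, c i • eb i := by
  unfold sv eb
  ext j
  · simp [Finset.sum_apply, Pi.single_apply, Prod.fst_sum]
  · simp [Prod.snd_sum]

lemma dd_sv (c : V3) (F : E4 → ℝ) (p : E4) : dd (sv c) F p = ∑ i, c i * dd (eb i) F p := by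
  unfold dd; rw [sv_eq]; simp [map_sum]

lemma dd_sv2 {O : Set E4} (hO : IsOpen O) {F : E4 → ℝ} (hF : Sm O F) {p : E4} (hp : p ∈ O)
    (c : V3) : dd (sv c) (dd (sv c) F) p = ∑ i, ∑ j, c i * c j * dd (eb i) (dd (eb j) F) p := by
  rw [dd_sv]
  refine Finset.sum_congr rfl fun i _ => ?_
  rw [dd_congr hO (F := dd (sv c) F) (G := fun p => ∑ j, c j * dd (eb j) F p)
    (fun q _ => dd_sv c F q) hp]
  have hd : ∀ j, DifferentiableAt ℝ (dd (eb j) F) p := fun j => (hF.dd hO _).diff hO hp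
  rw [dd_sum (fun j => (hd j).const_mul _), Finset.mul_sum]
  refine Finset.sum_congr rfl fun j _ => ?_
  rw [dd_cmul (hd j)]; ring

lemma dd_line {F : E4 → ℝ} {p e : E4} {t : ℝ} (hF : DifferentiableAt ℝ F (p + t • e)) :
    HasDerivAt (fun t : ℝ => F (p + t • e)) (dd e F (p + t • e)) t := by
  have h1 : HasDerivAt (fun t : ℝ => p + t • e) e t := by
    simpa using ((hasDerivAt_id t).smul_const e).const_add p
  exact hF.hasFDerivAt.comp_hasDerivAt t h1

lemma dd_div {F G : E4 → ℝ} {p : E4} (hF : DifferentiableAt ℝ F p) (hG : DifferentiableAt ℝ G p)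
    (h0 : G p ≠ 0) (e : E4) :
    dd e (fun p => F p / G p) p = (dd e F p * G p - F p * dd e G p) / G p ^ 2 := by
  have hF' := dd_line (F := F) (p := p) (e := e) (t := 0) (by simpa using hF)
  have hG' := dd_line (F := G) (p := p) (e := e) (t := 0) (by simpa using hG)
  have hd : DifferentiableAt ℝ (fun p => F p / G p) p := by
    simp only [div_eq_mul_inv]
    exact hF.mul (hG.inv h0)
  have hH' := dd_line (F := fun p => F p / G p) (p := p) (e := e) (t := 0) (by simpa using hd)
  have h := hH'.unique (hF'.div hG' (by simpa using h0))
  simpa using h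

/-- Second order test. -/
lemma second_test {O : Set E4} (hO : IsOpen O) {F : E4 → ℝ} (hF : Sm O F) {p : E4} (hp : p ∈ O)
    (e : E4) (he : e.2 = 0) (hmax : ∀ᶠ q in 𝓝 p, q.2 ≤ p.2 → F q ≤ F p) :
    dd e F p = 0 ∧ dd e (dd e F) p ≤ 0 := by
  have hc : Tendsto (fun t : ℝ => p + t • e) (𝓝 0) (𝓝 p) := by
    have : Continuous (fun t : ℝ => p + t • e) := by fun_prop
    simpa using this.tendsto 0
  have hin : ∀ᶠ t : ℝ in 𝓝 0, p + t • e ∈ O := hc.eventually (hO.mem_nhds hp)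
  set f : ℝ → ℝ := fun t => F (p + t • e) with hf
  have hloc : IsLocalMax f 0 := by
    filter_upwards [hc.eventually hmax] with t ht
    have := ht (by simp [he])
    simpa [hf] using this
  have hd1 : ∀ᶠ t in 𝓝 (0:ℝ), HasDerivAt f (dd e F (p + t • e)) t := by
    filter_upwards [hin] with t ht
    exact dd_line (hF.diff hO ht)
  have h0 : HasDerivAt f (dd e F p) 0 := by simpa using hd1.self_of_nhds
  have hz : dd e F p = 0 := hloc.hasDerivAt_eq_zero h0
  refine ⟨hz, ?_⟩
  by_contra hneg
  push Not at hneg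
  have hd' : deriv f =ᶠ[𝓝 0] fun t => dd e F (p + t • e) := by
    filter_upwards [hd1] with t ht using ht.deriv
  have h2 : deriv (deriv f) 0 = dd e (dd e F) p := by
    rw [hd'.deriv_eq]
    have := dd_line (F := dd e F) (p := p) (e := e) (t := 0)
      (by simpa using (hF.dd hO e).diff hO hp)
    simpa using this.deriv
  have hmin : IsLocalMin f 0 := by
    apply isLocalMin_of_deriv_deriv_pos
    · rw [h2]; exact hneg
    · rw [h0.deriv, hz]
    · exact h0.continuousAt
  have hconst : f =ᶠ[𝓝 0] fun _ => f 0 := by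
    filter_upwards [hloc, hmin] with t h1 h2 using le_antisymm h1 h2
  have h3 : deriv (deriv f) 0 = 0 := by
    rw [(hconst.deriv).deriv_eq]; simp
  rw [h2] at h3
  linarith

lemma time_test {F : E4 → ℝ} {p : E4} (hF : DifferentiableAt ℝ F p)
    (hmax : ∀ᶠ q in 𝓝 p, q.2 ≤ p.2 → F q ≤ F p) : 0 ≤ dd et F p := by
  have hc : Tendsto (fun t : ℝ => p + t • et) (𝓝 0) (𝓝 p) := by
    have : Continuous (fun t : ℝ => p + t • et) := by fun_prop
    simpa using this.tendsto 0
  have h := dd_line (F := F) (p := p) (e := et) (t := 0) (by simpa using hF)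
  simp only [zero_smul, add_zero] at h
  rw [hasDerivAt_iff_tendsto_slope] at h
  have h' := h.mono_left (nhdsWithin_mono (0:ℝ) (show Set.Iio (0:ℝ) ⊆ {0}ᶜ from by
    intro x hx; simp; exact ne_of_lt hx))
  apply ge_of_tendsto h'
  have h1 : ∀ᶠ t in 𝓝[<] (0:ℝ), F (p + t • et) ≤ F p ∧ t < 0 := by
    have a := (hc.eventually hmax).filter_mono (nhdsWithin_le_nhds (s := Set.Iio (0:ℝ)))
    filter_upwards [a, self_mem_nhdsWithin] with t ht h2
    have h2 : t < 0 := h2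
    exact ⟨ht (by simp [et]; linarith), h2⟩
  filter_upwards [h1] with t ht
  rw [slope_def_field]
  simp only [zero_smul, add_zero, sub_zero]
  exact div_nonneg_of_nonpos (by linarith [ht.1]) ht.2.le

end General

section Alg

/-- Trace with respect to `δ + d d / w`. -/
lemma alg_trace (d : Fin 3 → ℝ) (X : Fin 3 → Fin 3 → ℝ) (w : ℝ) (hw : 0 < w)
    (hX : ∀ c : Fin 3 → ℝ, ∑ i, ∑ j, c i * c j * X i j ≤ 0) :
    ∑ i, X i i + (∑ i, ∑ j, d i * d j * X i j) / w ≤ 0 := by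
  have h1 : ∀ i, X i i ≤ 0 := by
    intro i
    have := hX (Pi.single i 1)
    simpa [Pi.single_apply] using this
  have h2 : (∑ i, ∑ j, d i * d j * X i j) / w ≤ 0 := div_nonpos_of_nonpos_of_nonneg (hX d) hw.le
  have h3 : ∑ i, X i i ≤ 0 := Finset.sum_nonpos fun i _ => h1 i
  linarith

lemma alg_I0 (d Q ps : Fin 3 → ℝ) (h pp : Fin 3 → Fin 3 → ℝ) (T : Fin 3 → Fin 3 → Fin 3 → ℝ)
    (w B1 B2 : ℝ) (hQ : ∀ j, Q j = ∑ k, d k * h j k) (hs : ∀ i j, h i j = h j i) :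
    ∑ i, (2 * ∑ k, (h i k * h i k + d k * T i i k) - B1 * pp i i - B2 * (ps i * ps i)) +
      (∑ i, ∑ j, d i * d j * (2 * ∑ k, (h i k * h j k + d k * T i j k) - B1 * pp i j
        - B2 * (ps i * ps j))) / w =
    2 * ∑ i, ∑ k, h i k ^ 2 + 2 * (∑ k, Q k ^ 2) / w
      + 2 * ∑ k, d k * (∑ i, T i i k + (∑ i, ∑ j, d i * d j * T i j k) / w)
      - B1 * (∑ i, pp i i + (∑ i, ∑ j, d i * d j * pp i j) / w)
      - B2 * (∑ i, ps i ^ 2 + (∑ i, d i * ps i) ^ 2 / w) := by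
  simp only [hQ, Fin.sum_univ_three]
  rw [hs 1 0, hs 2 0, hs 2 1]
  ring

lemma alg_I2 (d x : Fin 3 → ℝ) (h : Fin 3 → Fin 3 → ℝ) (U w Z α r q dQ dx : ℝ)
    (hU : 0 < U) (hw : 0 < w) (hq : q = ∑ k, d k ^ 2) (hqw : w = 1 - q)
    (hdQ : dQ = ∑ i, ∑ j, d i * d j * h i j) (hdx : dx = ∑ i, d i * x i)
    (pp : Fin 3 → Fin 3 → ℝ)
    (hpp : ∀ i j, pp i j = (-α * Z * h i j / U + α * (α + 1) * Z * d i * d j / U ^ 2) * r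
      + (-α * Z * d i / U) * (2 * x j) + (-α * Z * d j / U) * (2 * x i) + 2 * Z * kd i j) :
    U ^ 2 * (∑ i, pp i i + (∑ i, ∑ j, d i * d j * pp i j) / w) =
      -α * (Z * r) * U * (∑ i, h i i + dQ / w) + α * (α + 1) * (Z * r) * q / w
        - 4 * α * U * Z * dx / w + 2 * U ^ 2 * Z * (3 + q / w) := by
  have e1 : ∑ i, pp i i = -α * Z / U * r * (∑ i, h i i) + α * (α + 1) * Z / U ^ 2 * r * q
      - 4 * α * Z / U * dx + 6 * Z := by
    simp only [hpp, hq, hdx, kd, Fin.sum_univ_three]; simp; ring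
  have e2 : ∑ i, ∑ j, d i * d j * pp i j = -α * Z / U * r * dQ
      + α * (α + 1) * Z / U ^ 2 * r * q ^ 2 - 4 * α * Z / U * dx * q + 2 * Z * q := by
    simp only [hpp, hq, hdx, hdQ, kd, Fin.sum_univ_three]; simp; ring
  rw [e1, e2]
  have e3 : q = 1 - w := by linarith
  rw [e3]
  field_simp
  ring

lemma alg_cs (d y : Fin 3 → ℝ) : (∑ i, d i * y i) ^ 2 ≤ (∑ i, d i ^ 2) * (∑ i, y i ^ 2) :=
  Finset.sum_mul_sq_le_sq_mul_sq _ _ _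

lemma alg_tr (h : Fin 3 → Fin 3 → ℝ) : (∑ i, h i i) ^ 2 ≤ 3 * ∑ i, ∑ k, h i k ^ 2 := by
  simp only [Fin.sum_univ_three]
  nlinarith [sq_nonneg (h 0 0 - h 1 1), sq_nonneg (h 0 0 - h 2 2), sq_nonneg (h 1 1 - h 2 2),
    sq_nonneg (h 0 1), sq_nonneg (h 0 2), sq_nonneg (h 1 2), sq_nonneg (h 1 0),
    sq_nonneg (h 2 0), sq_nonneg (h 2 1)]

/-- Bound on the gradient of the cutoff. -/
lemma alg_grad (d x ps : Fin 3 → ℝ) (U Z α r q ψ μ : ℝ) (hU : 0 < U) (hZ : 0 < Z)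
    (hr : r = ∑ i, x i ^ 2) (hq : q = ∑ k, d k ^ 2) (hq1 : q ≤ 1)
    (hψ : ψ = Z * r) (hψ1 : ψ ≤ 1) (hμ : U ^ 2 * Z ≤ μ)
    (hps : ∀ i, ps i = -α * Z * d i / U * r + Z * (2 * x i)) :
    U ^ 2 * ∑ i, ps i ^ 2 ≤ 2 * α ^ 2 + 8 * μ := by
  have hr0 : 0 ≤ r := by rw [hr]; positivity
  have hψ0 : 0 ≤ ψ := by rw [hψ]; positivity
  have e : ∀ i, U ^ 2 * ps i ^ 2 ≤ 2 * (α * ψ) ^ 2 * d i ^ 2 + 8 * (U * Z) ^ 2 * x i ^ 2 := by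
    intro i
    have : U * ps i = -(α * ψ) * d i + 2 * (U * Z) * x i := by
      rw [hps, hψ]; field_simp
    have h2 : U ^ 2 * ps i ^ 2 = (-(α * ψ) * d i + 2 * (U * Z) * x i) ^ 2 := by rw [← this]; ring
    rw [h2]
    nlinarith [sq_nonneg (α * ψ * d i + 2 * (U * Z) * x i)]
  have e2 : U ^ 2 * ∑ i, ps i ^ 2 ≤ 2 * (α * ψ) ^ 2 * q + 8 * (U * Z) ^ 2 * r := by
    rw [hq, hr, Finset.mul_sum, Finset.mul_sum, Finset.mul_sum, ← Finset.sum_add_distrib]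
    exact Finset.sum_le_sum fun i _ => e i
  have hq0 : 0 ≤ q := by rw [hq]; positivity
  have e3 : (α * ψ) ^ 2 * q ≤ α ^ 2 := by
    have : ψ ^ 2 * q ≤ 1 := by
      have : ψ ^ 2 ≤ 1 := by nlinarith
      nlinarith [sq_nonneg ψ]
    nlinarith [sq_nonneg α]
  have e4 : (U * Z) ^ 2 * r ≤ μ := by
    have : (U * Z) ^ 2 * r = (U ^ 2 * Z) * ψ := by rw [hψ]; ring
    rw [this]
    have h5 : 0 ≤ U ^ 2 * Z := by positivity
    nlinarith
  linarith

/-- Bound on the second order cutoff error. -/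
lemma alg_E (U w Z α q ψ μ κ dx r : ℝ) (hU : 0 < U) (hZ : 0 < Z) (hκ : 0 < κ)
    (hκw : κ ≤ w) (hα : 0 < α) (hα1 : α ≤ 1) (hq0 : 0 ≤ q) (hqw : w = 1 - q)
    (hψ : ψ = Z * r) (hψ0 : 0 ≤ ψ) (hψ1 : ψ ≤ 1) (hμ : U ^ 2 * Z ≤ μ)
    (hdx : dx ^ 2 ≤ q * r) (hr0 : 0 ≤ r) :
    -3 * α * ψ + α * (α + 1) * ψ * q / w - 4 * α * U * Z * dx / w + 2 * U ^ 2 * Z * (3 + q / w)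
      ≤ 10 * (α + μ) / κ := by
  have hw : 0 < w := by linarith
  have hw1 : w ≤ 1 := by linarith
  have h5 : 0 ≤ U ^ 2 * Z := by positivity
  have e0 : -3 * α * ψ + α * (α + 1) * ψ * q / w - 4 * α * U * Z * dx / w
      + 2 * U ^ 2 * Z * (3 + q / w) =
      -3 * α * ψ + (α * (α + 1) * ψ * q - 4 * α * U * Z * dx + 2 * U ^ 2 * Z * (3 * w + q)) / w := by
    field_simp
    ring
  rw [e0]
  have a1 : α * (α + 1) * ψ * q ≤ 2 * α := by
    have : ψ * q ≤ 1 := by nlinarith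
    have h2 : α * (α + 1) ≤ 2 * α := by nlinarith
    have h3 : 0 ≤ ψ * q := by positivity
    nlinarith
  have a2 : -4 * α * U * Z * dx ≤ 2 * α ^ 2 + 2 * μ := by
    have : (U * Z * dx) ^ 2 ≤ μ := by
      calc (U * Z * dx) ^ 2 = (U * Z) ^ 2 * dx ^ 2 := by ring
        _ ≤ (U * Z) ^ 2 * (q * r) := by gcongr
        _ ≤ (U * Z) ^ 2 * (1 * r) := by gcongr; linarith
        _ = U ^ 2 * Z * ψ := by rw [hψ]; ring
        _ ≤ U ^ 2 * Z := by nlinarith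
        _ ≤ μ := hμ
    nlinarith [sq_nonneg (α + U * Z * dx)]
  have a3 : 2 * U ^ 2 * Z * (3 * w + q) ≤ 6 * μ := by
    have : 3 * w + q ≤ 3 := by linarith
    nlinarith
  have a4 : α * (α + 1) * ψ * q - 4 * α * U * Z * dx + 2 * U ^ 2 * Z * (3 * w + q)
      ≤ 10 * (α + μ) := by nlinarith
  have a5 : (α * (α + 1) * ψ * q - 4 * α * U * Z * dx + 2 * U ^ 2 * Z * (3 * w + q)) / w
      ≤ 10 * (α + μ) / κ := by
    have hp : 0 ≤ 10 * (α + μ) := by linarith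
    exact div_le_div₀ hp a4 hκ hκw
  have a6 : 0 ≤ α * ψ := by positivity
  linarith

set_option maxHeartbeats 1000000 in
/-- Final scalar inequality. -/
lemma alg_final (U q w κ ε m σ lam B1 B2 H1 H2 Q2 dQ P2 dP E : ℝ)
    (hκ : 0 < κ) (hκ1 : κ ≤ 1) (hκw : κ ≤ w) (hqw : w = 1 - q) (hq0 : 0 ≤ q)
    (hε : 0 ≤ ε) (hm : 1 ≤ m) (hlam : 0 < lam) (hlam1 : lam ≤ 1)
    (hB1 : 0 ≤ B1) (hB1m : B1 ≤ m) (hB2 : 0 ≤ B2) (hB2m : B2 ≤ m ^ 2)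
    (hH : H1 ^ 2 ≤ 3 * H2) (hQ2 : U ^ 2 * Q2 = B1 ^ 2 * (U ^ 2 * P2) / 4)
    (hP2 : U ^ 2 * P2 ≤ ε) (hP20 : 0 ≤ P2) (hdQ : dQ ^ 2 ≤ q * Q2) (hdP : dP ^ 2 ≤ q * P2)
    (hE : E ≤ ε / κ)
    (main : 6 * q ≤ σ + 4 * U * q * (H1 + dQ / w) - 2 * U ^ 2 * H2 + 2 * U ^ 2 * Q2 / w
      + 4 * U ^ 2 * dQ ^ 2 / w ^ 2 + B1 * E + U ^ 2 * B2 * (P2 + dP ^ 2 / w)) :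
    6 * q * w ≤ σ + lam + 5 * m ^ 2 * ε / (κ ^ 2 * lam) := by
  have hw : 0 < w := by linarith
  have hw1 : w ≤ 1 := by linarith
  have hκ2 : κ ^ 2 ≤ κ := by nlinarith
  have hm2 : m ≤ m ^ 2 := by nlinarith
  obtain ⟨R, hR⟩ : ∃ R, R = m ^ 2 * ε / κ ^ 2 := ⟨_, rfl⟩
  have hR0 : 0 ≤ R := by rw [hR]; positivity
  have hRκ : ε * m ^ 2 = R * κ ^ 2 := by rw [hR]; field_simp
  have hUP : 0 ≤ U ^ 2 * P2 := by positivity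
  -- Q2
  have q2 : U ^ 2 * Q2 ≤ m ^ 2 * ε / 4 := by
    rw [hQ2]
    have : B1 ^ 2 ≤ m ^ 2 := by gcongr
    have : B1 ^ 2 * (U ^ 2 * P2) ≤ m ^ 2 * ε := by gcongr
    linarith
  have hUQ : 0 ≤ U ^ 2 * Q2 := by rw [hQ2]; positivity
  have dq2 : (U * dQ) ^ 2 ≤ m ^ 2 * ε / 4 := by
    have : U ^ 2 * dQ ^ 2 ≤ U ^ 2 * (q * Q2) := by gcongr
    have h2 : q * (U ^ 2 * Q2) ≤ 1 * (U ^ 2 * Q2) := by gcongr; linarith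
    have h3 : (U * dQ) ^ 2 = U ^ 2 * dQ ^ 2 := by ring
    have h4 : U ^ 2 * (q * Q2) = q * (U ^ 2 * Q2) := by ring
    linarith
  have t1 : 2 * U ^ 2 * Q2 / w ≤ R / 2 := by
    rw [div_le_iff₀ hw]
    have h1 : R * κ ^ 2 ≤ R * w := by gcongr; linarith
    linarith
  have t2 : 4 * U ^ 2 * dQ ^ 2 / w ^ 2 ≤ R := by
    rw [div_le_iff₀ (by positivity)]
    have : κ ^ 2 ≤ w ^ 2 := by gcongr
    have h1 : R * κ ^ 2 ≤ R * w ^ 2 := by gcongr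
    have h3 : (U * dQ) ^ 2 = U ^ 2 * dQ ^ 2 := by ring
    linarith
  have t3 : B1 * E ≤ R := by
    have h1 : B1 * E ≤ B1 * (ε / κ) := by gcongr
    have h2 : B1 * (ε / κ) ≤ m ^ 2 * (ε / κ) := by
      have : B1 ≤ m ^ 2 := by linarith
      gcongr
    have h3 : m ^ 2 * (ε / κ) ≤ R := by
      rw [hR, mul_div_assoc]; gcongr
    linarith
  have t4 : U ^ 2 * B2 * (P2 + dP ^ 2 / w) ≤ R := by
    have h1 : P2 + dP ^ 2 / w ≤ P2 / w := by
      rw [le_div_iff₀ hw, add_mul, div_mul_cancel₀ _ hw.ne']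
      have h9 : P2 * w = P2 - q * P2 := by rw [hqw]; ring
      linarith
    have h2 : U ^ 2 * B2 * (P2 + dP ^ 2 / w) ≤ U ^ 2 * B2 * (P2 / w) := by gcongr
    have h3 : U ^ 2 * B2 * (P2 / w) = B2 * (U ^ 2 * P2) / w := by ring
    rw [hR]
    have h4 : B2 * (U ^ 2 * P2) / w ≤ m ^ 2 * ε / κ ^ 2 :=
      div_le_div₀ (by positivity) (by gcongr) (by positivity) (by linarith)
    linarith
  have t5 : 4 * U * q * (dQ / w) ≤ lam + R / lam := by
    have h1 : 4 * U * q * (dQ / w) = 4 * (U * dQ) * q / w := by ring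
    rw [h1, div_le_iff₀ hw]
    have h2 : lam * (R / lam) = R := by field_simp
    have hRl : 0 ≤ R / lam := by positivity
    -- 4 y q ≤ 4|y| ; (lam + R/lam) w ≥ 2 sqrt R κ ; 
    have h3 : (4 * (U * dQ) * q) ^ 2 ≤ ((lam + R / lam) * w) ^ 2 := by
      have a1 : (4 * (U * dQ) * q) ^ 2 ≤ 4 * (m ^ 2 * ε) := by
        have hq2 : q ^ 2 ≤ 1 := pow_le_one₀ hq0 (by linarith)
        have : (4 * (U * dQ) * q) ^ 2 = 16 * ((U * dQ) ^ 2 * q ^ 2) := by ring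
        rw [this]
        have : (U * dQ) ^ 2 * q ^ 2 ≤ m ^ 2 * ε / 4 * 1 := by gcongr
        linarith
      have a2 : 4 * R ≤ (lam + R / lam) ^ 2 := by
        have hh := sq_nonneg (lam - R / lam)
        have h7 : (lam + R / lam) ^ 2 = (lam - R / lam) ^ 2 + 4 * (lam * (R / lam)) := by ring
        rw [h7, h2]; linarith
      have a3 : κ ^ 2 ≤ w ^ 2 := by gcongr
      have a4 : 4 * R * κ ^ 2 ≤ (lam + R / lam) ^ 2 * w ^ 2 := by gcongr
      rw [mul_pow]
      linarith
    exact abs_le_of_sq_le_sq' h3 (by positivity) |>.2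
  have t6 : 4 * U * q * H1 - 2 * U ^ 2 * H2 ≤ 6 * q ^ 2 := by
    have : U ^ 2 * H1 ^ 2 ≤ U ^ 2 * (3 * H2) := by gcongr
    have hh := sq_nonneg (U * H1 - 3 * q)
    have h7 : (U * H1 - 3 * q) ^ 2 = U ^ 2 * H1 ^ 2 - 6 * U * q * H1 + 9 * q ^ 2 := by ring
    linarith
  have t7 : R / 2 + R + R + R + R / lam ≤ 5 * m ^ 2 * ε / (κ ^ 2 * lam) := by
    have : 5 * m ^ 2 * ε / (κ ^ 2 * lam) = 5 * (R / lam) := by rw [hR]; field_simp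
    rw [this]
    have : R ≤ R / lam := by
      rw [le_div_iff₀ hlam]; exact mul_le_of_le_one_right hR0 hlam1
    linarith
  have e8 : 6 * q * w = 6 * q - 6 * q ^ 2 := by rw [hqw]; ring
  rw [e8]
  have e9 : 4 * U * q * (H1 + dQ / w) = 4 * U * q * H1 + 4 * U * q * (dQ / w) := by ring
  linarith

end Alg

section Alg2

lemma alg_I1 (d Q Ut : Fin 3 → ℝ) (h : Fin 3 → Fin 3 → ℝ) (T : Fin 3 → Fin 3 → Fin 3 → ℝ)
    (U w q dQ Lam : ℝ) (hw : 0 < w) (hQ : ∀ j, Q j = ∑ k, d k * h j k)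
    (hs : ∀ i j, h i j = h j i) (hq : q = ∑ k, d k ^ 2)
    (hdQ : dQ = ∑ i, ∑ j, d i * d j * h i j)
    (hUt : ∀ k, Ut k = 2 * U * d k * Lam + U ^ 2 * (∑ i, T i i k
      + ((∑ i, ∑ j, (h k i * d j * h i j + d i * h k j * h i j + d i * d j * T i j k)) * w
        - dQ * (- ∑ l, 2 * d l * h k l)) / w ^ 2) - 3 * d k) :
    ∑ k, d k * Ut k = 2 * U * q * Lam + U ^ 2 *
      (∑ k, d k * (∑ i, T i i k + (∑ i, ∑ j, d i * d j * T i j k) / w)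
        + 2 * (∑ k, Q k ^ 2) / w + 2 * dQ ^ 2 / w ^ 2) - 3 * q := by
  have hk : ∀ k, (∑ i, ∑ j, (h k i * d j * h i j + d i * h k j * h i j + d i * d j * T i j k))
      = 2 * ∑ i, h k i * Q i + ∑ i, ∑ j, d i * d j * T i j k := by
    intro k
    simp only [hQ, Fin.sum_univ_three]
    rw [hs 1 0, hs 2 0, hs 2 1]
    ring
  have hk2 : ∀ k, (∑ l, 2 * d l * h k l) = 2 * Q k := by
    intro k
    simp only [hQ, Fin.sum_univ_three]
    ring
  have hUt' : ∀ k, d k * Ut k = 2 * U * Lam * d k ^ 2 + U ^ 2 * (d k * (∑ i, T i i k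
      + (∑ i, ∑ j, d i * d j * T i j k) / w)) + U ^ 2 * (2 / w) * (d k * ∑ i, h k i * Q i)
      + U ^ 2 * (2 * dQ / w ^ 2) * (d k * Q k) - 3 * d k ^ 2 := by
    intro k
    rw [hUt, hk, hk2]
    field_simp
    ring
  have e1 : ∑ k, d k * ∑ i, h k i * Q i = ∑ k, Q k ^ 2 := by
    simp only [hQ, Fin.sum_univ_three]
    rw [hs 1 0, hs 2 0, hs 2 1]
    ring
  have e2 : ∑ k, d k * Q k = dQ := by
    simp only [hQ, hdQ, Fin.sum_univ_three]
    ring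
  calc ∑ k, d k * Ut k = 2 * U * Lam * ∑ k, d k ^ 2 + U ^ 2 * ∑ k, (d k * (∑ i, T i i k
      + (∑ i, ∑ j, d i * d j * T i j k) / w)) + U ^ 2 * (2 / w) * ∑ k, (d k * ∑ i, h k i * Q i)
      + U ^ 2 * (2 * dQ / w ^ 2) * ∑ k, (d k * Q k) - 3 * ∑ k, d k ^ 2 := by
        simp only [hUt', Finset.sum_add_distrib, Finset.sum_sub_distrib, Finset.mul_sum]
    _ = _ := by rw [e1, e2, ← hq]; ring

set_option maxHeartbeats 1000000 in
lemma alg_main (d x ps Ut : Fin 3 → ℝ) (h pp : Fin 3 → Fin 3 → ℝ)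
    (T : Fin 3 → Fin 3 → Fin 3 → ℝ)
    (U w q Us Z α r ψ κ μ σ lam : ℝ) (M : ℕ)
    (hU : 0 < U) (hZ : 0 < Z) (hκ : 0 < κ) (hκ1 : κ ≤ 1) (hκw : κ ≤ w) (hα : 0 < α) (hα1 : α ≤ 1)
    (hlam : 0 < lam) (hlam1 : lam ≤ 1)
    (hs : ∀ i j, h i j = h j i) (hq : q = ∑ k, d k ^ 2) (hqw : w = 1 - q)
    (hr : r = ∑ i, x i ^ 2) (hψ : ψ = Z * r) (hψ1 : ψ ≤ 1) (hμ : U ^ 2 * Z ≤ μ)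
    (hUs : Us = U ^ 2 * (∑ i, h i i + (∑ i, ∑ j, d i * d j * h i j) / w) - 3 * U)
    (hUt : ∀ k, Ut k = 2 * U * d k * (∑ i, h i i + (∑ i, ∑ j, d i * d j * h i j) / w)
      + U ^ 2 * (∑ i, T i i k
      + ((∑ i, ∑ j, (h k i * d j * h i j + d i * h k j * h i j + d i * d j * T i j k)) * w
        - (∑ i, ∑ j, d i * d j * h i j) * (- ∑ l, 2 * d l * h k l)) / w ^ 2) - 3 * d k)
    (hps : ∀ i, ps i = -α * Z * d i / U * r + Z * (2 * x i))
    (hpp : ∀ i j, pp i j = (-α * Z * h i j / U + α * (α + 1) * Z * d i * d j / U ^ 2) * r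
      + (-α * Z * d i / U) * (2 * x j) + (-α * Z * d j / U) * (2 * x i) + 2 * Z * kd i j)
    (h1 : ∀ j, ∑ k, 2 * d k * h j k = (M + 2) * ψ ^ (M + 1) * ps j)
    (h2 : ∀ c : Fin 3 → ℝ, ∑ i, ∑ j, c i * c j * (2 * ∑ k, (h i k * h j k + d k * T i j k)
      - (M + 2) * ψ ^ (M + 1) * pp i j - (M + 2) * (M + 1) * ψ ^ M * (ps i * ps j)) ≤ 0)
    (ht : 0 ≤ ∑ k, 2 * d k * Ut k - (M + 2) * ψ ^ (M + 1) * (-α * Z * Us / U * r) + σ) :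
    6 * q * w ≤ σ + lam + 5 * (M + 2) ^ 2 * (10 * (α + μ)) / (κ ^ 2 * lam) := by
  have hw : 0 < w := by linarith
  have hr0 : 0 ≤ r := by rw [hr]; positivity
  have hψ0 : 0 ≤ ψ := by rw [hψ]; positivity
  have hq0 : 0 ≤ q := by rw [hq]; positivity
  have hq1 : q ≤ 1 := by linarith
  have hμ0 : 0 ≤ μ := le_trans (by positivity) hμ
  obtain ⟨Q, hQ⟩ : ∃ Q : Fin 3 → ℝ, ∀ j, Q j = ∑ k, d k * h j k := ⟨_, fun _ => rfl⟩
  obtain ⟨dQ, hdQ⟩ : ∃ a, a = ∑ i, ∑ j, d i * d j * h i j := ⟨_, rfl⟩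
  obtain ⟨dx, hdx⟩ : ∃ a, a = ∑ i, d i * x i := ⟨_, rfl⟩
  obtain ⟨B1, hB1⟩ : ∃ a : ℝ, a = (M + 2) * ψ ^ (M + 1) := ⟨_, rfl⟩
  obtain ⟨B2, hB2⟩ : ∃ a : ℝ, a = (M + 2) * (M + 1) * ψ ^ M := ⟨_, rfl⟩
  have hQ1 : ∀ j, Q j = B1 / 2 * ps j := by
    intro j
    have := h1 j
    rw [← hB1] at this
    have e : ∑ k, 2 * d k * h j k = 2 * Q j := by
      rw [hQ, Finset.mul_sum]; exact Finset.sum_congr rfl fun k _ => by ring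
    rw [e] at this
    linarith
  have hdQ' : dQ = ∑ i, d i * Q i := by
    rw [hdQ]
    refine Finset.sum_congr rfl fun i _ => ?_
    rw [hQ, Finset.mul_sum]; exact Finset.sum_congr rfl fun k _ => by ring
  have I1 := alg_I1 d Q Ut h T U w q dQ _ hw hQ hs hq hdQ (by rw [hdQ]; exact hUt)
  have I2 := alg_I2 d x h U w Z α r q dQ dx hU hw hq hqw hdQ hdx pp hpp
  have I0 := alg_I0 d Q ps h pp T w B1 B2 hQ hs
  have A := alg_trace d (fun i j => 2 * ∑ k, (h i k * h j k + d k * T i j k)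
      - B1 * pp i j - B2 * (ps i * ps j)) w hw (by rw [hB1, hB2]; exact h2)
  rw [I0] at A
  have E := alg_E U w Z α q ψ μ κ dx r hU hZ hκ hκw hα hα1 hq0 hqw hψ hψ0 hψ1 hμ
    (by rw [hdx, hq, hr]; exact alg_cs d x) hr0
  have G := alg_grad d x ps U Z α r q ψ μ hU hZ hr hq hq1 hψ hψ1 hμ hps
  rw [← hdQ] at hUs I1
  obtain ⟨Lam, hLam⟩ : ∃ a, a = ∑ i, h i i + dQ / w := ⟨_, rfl⟩
  rw [← hLam] at hUs I1 I2
  rw [← hB1] at ht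
  have hM0 : (0:ℝ) ≤ M := by positivity
  have ht' : ∑ k, 2 * d k * Ut k = 2 * ∑ k, d k * Ut k := by
    rw [Finset.mul_sum]; exact Finset.sum_congr rfl fun k _ => by ring
  rw [ht', I1] at ht
  have hψs : -α * Z * Us / U * r = -α * ψ * (U * Lam - 3) := by
    rw [hUs, hψ]; field_simp
  rw [hψs] at ht
  rw [← hψ] at I2
  obtain ⟨Ev, hEv⟩ : ∃ a, a = -3 * α * ψ + α * (α + 1) * ψ * q / w - 4 * α * U * Z * dx / w
    + 2 * U ^ 2 * Z * (3 + q / w) := ⟨_, rfl⟩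
  rw [← hEv] at E
  have hA2 := mul_nonpos_of_nonneg_of_nonpos (sq_nonneg U) A
  have hI2' : U ^ 2 * (∑ i, pp i i + (∑ i, ∑ j, d i * d j * pp i j) / w)
      = -α * ψ * (U * Lam - 3) + Ev := by rw [I2, hEv]; ring
  refine alg_final U q w κ (10 * (α + μ)) (M + 2) σ lam B1 B2 (∑ i, h i i)
    (∑ i, ∑ k, h i k ^ 2) (∑ k, Q k ^ 2) dQ (∑ i, ps i ^ 2) (∑ i, d i * ps i) Ev hκ hκ1 hκw hqw hq0
    (by positivity) (by linarith) hlam hlam1 (by rw [hB1]; positivity) ?_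
    (by rw [hB2]; positivity) ?_ (alg_tr h) ?_ ?_ (by positivity) ?_ ?_ E ?_
  · rw [hB1]
    exact mul_le_of_le_one_right (by linarith) (pow_le_one₀ hψ0 hψ1)
  · rw [hB2]
    have : ((M:ℝ) + 2) * (M + 1) ≤ (M + 2) ^ 2 := by
      rw [sq]; gcongr; norm_num
    exact le_trans (mul_le_of_le_one_right (by positivity) (pow_le_one₀ hψ0 hψ1)) this
  · simp only [hQ1, mul_pow, ← Finset.mul_sum]; ring
  · have : α ^ 2 ≤ α := by rw [sq]; exact mul_le_of_le_one_right hα.le hα1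
    linarith
  · rw [hdQ', hq]; exact alg_cs d Q
  · rw [hq]; exact alg_cs d ps
  · rw [← hLam]
    generalize (∑ i, pp i i + (∑ i, ∑ j, d i * d j * pp i j) / w) = PP at *
    generalize (∑ k, d k * (∑ i, T i i k + (∑ i, ∑ j, d i * d j * T i j k) / w)) = TT at *
    generalize (∑ i, d i * ps i) = dP at *
    generalize (∑ i, ps i ^ 2) = P2 at *
    generalize (∑ i, ∑ k, h i k ^ 2) = H2 at *
    generalize (∑ k, Q k ^ 2) = Q2 at *
    have e1 : U ^ 2 * (2 * H2 + 2 * Q2 / w + 2 * TT - B1 * PP - B2 * (P2 + dP ^ 2 / w))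
       = 2 * U ^ 2 * H2 + 2 * U ^ 2 * Q2 / w + 2 * (U ^ 2 * TT) - B1 * (U ^ 2 * PP)
         - U ^ 2 * B2 * (P2 + dP ^ 2 / w) := by ring
    rw [e1, hI2'] at hA2
    have e2 : 2 * (2 * U * q * Lam + U ^ 2 * (TT + 2 * Q2 / w + 2 * dQ ^ 2 / w ^ 2) - 3 * q)
       = 4 * U * q * Lam + 2 * (U ^ 2 * TT) + 2 * (2 * U ^ 2 * Q2 / w)
         + 4 * U ^ 2 * dQ ^ 2 / w ^ 2 - 6 * q := by ring
    rw [e2] at ht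
    linarith

end Alg2

section Core

open Real Filter Topology

lemma Sm.mul {O : Set E4} {F G : E4 → ℝ} (hF : Sm O F) (hG : Sm O G) :
    Sm O (fun p => F p * G p) := ContDiffOn.mul hF hG

lemma Sm.rho (O : Set E4) : Sm O (fun p : E4 => ∑ i, p.1 i ^ 2) := by
  unfold Sm
  apply ContDiff.contDiffOn
  fun_prop

lemma coord_diff (i : Fin 3) (p : E4) : DifferentiableAt ℝ (fun p : E4 => p.1 i) p := by
  fun_prop

lemma dd_rho (p e : E4) : dd e (fun p : E4 => ∑ i, p.1 i ^ 2) p = ∑ i, 2 * p.1 i * e.1 i := by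
  rw [dd_sum (F := fun i p => p.1 i ^ 2) (fun i => (coord_diff i p).pow 2)]
  refine Finset.sum_congr rfl fun i _ => ?_
  rw [dd_pow (F := fun p : E4 => p.1 i) (coord_diff i p) 1, dd_coord]
  norm_num

lemma dd_rho_eb (p : E4) (j : Fin 3) :
    dd (eb j) (fun p : E4 => ∑ i, p.1 i ^ 2) p = 2 * p.1 j := by
  rw [dd_rho]
  simp [eb, Pi.single_apply]

lemma dd_rho_et (p : E4) : dd et (fun p : E4 => ∑ i, p.1 i ^ 2) p = 0 := by
  rw [dd_rho]
  simp [et]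

lemma psi_d1 {O : Set E4} (hO : IsOpen O) {U Z : E4 → ℝ} (hZ : Sm O Z) {α : ℝ}
    (hZd : ∀ e, ∀ p ∈ O, dd e Z p = -α * Z p * dd e U p / U p)
    {p : E4} (hp : p ∈ O) (j : Fin 3) :
    dd (eb j) (fun p => Z p * ∑ i, p.1 i ^ 2) p =
      -α * Z p * dd (eb j) U p / U p * (∑ i, p.1 i ^ 2) + Z p * (2 * p.1 j) := by
  rw [dd_mul (hZ.diff hO hp) ((Sm.rho O).diff hO hp), dd_rho_eb, hZd _ p hp]

lemma psi_dt {O : Set E4} (hO : IsOpen O) {U Z : E4 → ℝ} (hZ : Sm O Z) {α : ℝ}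
    (hZd : ∀ e, ∀ p ∈ O, dd e Z p = -α * Z p * dd e U p / U p)
    {p : E4} (hp : p ∈ O) :
    dd et (fun p => Z p * ∑ i, p.1 i ^ 2) p =
      -α * Z p * dd et U p / U p * (∑ i, p.1 i ^ 2) := by
  rw [dd_mul (hZ.diff hO hp) ((Sm.rho O).diff hO hp), dd_rho_et, hZd _ p hp]; ring

lemma psi_d2 {O : Set E4} (hO : IsOpen O) {U Z : E4 → ℝ} (hU : Sm O U) (hZ : Sm O Z)
    (hUpos : ∀ p ∈ O, 0 < U p) {α : ℝ}
    (hZd : ∀ e, ∀ p ∈ O, dd e Z p = -α * Z p * dd e U p / U p)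
    {p : E4} (hp : p ∈ O) (i j : Fin 3) :
    dd (eb i) (dd (eb j) (fun p => Z p * ∑ i, p.1 i ^ 2)) p =
      (-α * Z p * dd (eb i) (dd (eb j) U) p / U p
        + α * (α + 1) * Z p * dd (eb i) U p * dd (eb j) U p / U p ^ 2) * (∑ i, p.1 i ^ 2)
      + (-α * Z p * dd (eb i) U p / U p) * (2 * p.1 j)
      + (-α * Z p * dd (eb j) U p / U p) * (2 * p.1 i) + 2 * Z p * kd i j := by
  rw [dd_congr hO (fun q hq => psi_d1 hO hZ hZd hq j) hp]
  have dZ := hZ.diff hO hp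
  have dU := hU.diff hO hp
  have dUj := (hU.dd hO (eb j)).diff hO hp
  have dr := (Sm.rho O).diff hO hp
  have U0 := (hUpos p hp).ne'
  have dc := coord_diff j p
  have n1 : DifferentiableAt ℝ (fun p => -α * Z p) p := dZ.const_mul _
  have n2 : DifferentiableAt ℝ (fun p => -α * Z p * dd (eb j) U p) p := n1.mul dUj
  have n3 : DifferentiableAt ℝ (fun p => -α * Z p * dd (eb j) U p / U p) p := by
    simp only [div_eq_mul_inv]; exact n2.mul (dU.inv U0)
  have n4 : DifferentiableAt ℝ (fun p : E4 => 2 * p.1 j) p := dc.const_mul _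
  have n5 : DifferentiableAt ℝ (fun p : E4 => -α * Z p * dd (eb j) U p / U p *
    (∑ i, p.1 i ^ 2)) p := n3.mul dr
  have n6 : DifferentiableAt ℝ (fun p : E4 => Z p * (2 * p.1 j)) p := dZ.mul n4
  rw [dd_add n5 n6, dd_mul n3 dr, dd_div n2 dU U0, dd_mul n1 dUj, dd_cmul dZ, dd_mul dZ n4,
    dd_cmul dc, dd_coord, dd_rho_eb, hZd _ p hp]
  have : (eb i).1 j = kd i j := by
    simp [eb, kd, Pi.single_apply, eq_comm]
  rw [this]
  field_simp
  ring

lemma G_d1 {O : Set E4} (hO : IsOpen O) {U Z : E4 → ℝ} (hU : Sm O U) (hZ : Sm O Z)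
    (σ : ℝ) (M : ℕ) {p : E4} (hp : p ∈ O) (e : E4) :
    dd e (fun p => ∑ k, dd (eb k) U p ^ 2 - (Z p * ∑ i, p.1 i ^ 2) ^ (M + 2) + σ * p.2) p =
      ∑ k, 2 * dd (eb k) U p * dd e (dd (eb k) U) p
        - (M + 2) * (Z p * ∑ i, p.1 i ^ 2) ^ (M + 1) * dd e (fun p => Z p * ∑ i, p.1 i ^ 2) p
        + σ * e.2 := by
  have dU : ∀ k, DifferentiableAt ℝ (dd (eb k) U) p := fun k => (hU.dd hO (eb k)).diff hO hp
  have dψ : DifferentiableAt ℝ (fun p : E4 => Z p * ∑ i, p.1 i ^ 2) p :=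
    (hZ.mul (Sm.rho O)).diff hO hp
  have n0 : ∀ k, DifferentiableAt ℝ (fun p => dd (eb k) U p ^ 2) p := fun k => (dU k).pow 2
  have n1 : DifferentiableAt ℝ (fun p => ∑ k, dd (eb k) U p ^ 2) p := by fun_prop
  have n2 : DifferentiableAt ℝ (fun p : E4 => (Z p * ∑ i, p.1 i ^ 2) ^ (M + 2)) p := dψ.pow _
  have n3 : DifferentiableAt ℝ (fun p : E4 => p.2) p := by fun_prop
  rw [dd_add (n1.fun_sub n2) (n3.const_mul σ), dd_sub n1 n2, dd_cmul n3, dd_time, dd_sum n0,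
    dd_pow dψ (M + 1)]
  congr 2
  · refine Finset.sum_congr rfl fun k _ => ?_
    rw [dd_pow (dU k) 1]; norm_num
  · push_cast; ring

lemma G_d2 {O : Set E4} (hO : IsOpen O) {U Z : E4 → ℝ} (hU : Sm O U) (hZ : Sm O Z)
    (σ : ℝ) (M : ℕ) {p : E4} (hp : p ∈ O) (i j : Fin 3) :
    dd (eb i) (dd (eb j) (fun p => ∑ k, dd (eb k) U p ^ 2 - (Z p * ∑ i, p.1 i ^ 2) ^ (M + 2)
        + σ * p.2)) p =
      2 * ∑ k, (dd (eb i) (dd (eb k) U) p * dd (eb j) (dd (eb k) U) p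
        + dd (eb k) U p * dd (eb i) (dd (eb j) (dd (eb k) U)) p)
        - (M + 2) * (Z p * ∑ i, p.1 i ^ 2) ^ (M + 1)
          * dd (eb i) (dd (eb j) (fun p => Z p * ∑ i, p.1 i ^ 2)) p
        - (M + 2) * (M + 1) * (Z p * ∑ i, p.1 i ^ 2) ^ M
          * (dd (eb i) (fun p => Z p * ∑ i, p.1 i ^ 2) p
            * dd (eb j) (fun p => Z p * ∑ i, p.1 i ^ 2) p) := by
  rw [dd_congr hO (fun q hq => G_d1 hO hU hZ σ M hq (eb j)) hp]
  have dU : ∀ k, DifferentiableAt ℝ (dd (eb k) U) p := fun k => (hU.dd hO (eb k)).diff hO hp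
  have dUj : ∀ k, DifferentiableAt ℝ (dd (eb j) (dd (eb k) U)) p :=
    fun k => ((hU.dd hO (eb k)).dd hO _).diff hO hp
  have sψ : Sm O (fun p : E4 => Z p * ∑ i, p.1 i ^ 2) := hZ.mul (Sm.rho O)
  have dψ := sψ.diff hO hp
  have dψj := (sψ.dd hO (eb j)).diff hO hp
  have n0 : ∀ k, DifferentiableAt ℝ (fun p => 2 * dd (eb k) U p) p := fun k => (dU k).const_mul 2
  have n1 : ∀ k, DifferentiableAt ℝ (fun p => 2 * dd (eb k) U p * dd (eb j) (dd (eb k) U) p) p :=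
    fun k => (n0 k).mul (dUj k)
  have n2 : DifferentiableAt ℝ
    (fun p => ∑ k, 2 * dd (eb k) U p * dd (eb j) (dd (eb k) U) p) p := by fun_prop
  have n3 : DifferentiableAt ℝ (fun p : E4 => (Z p * ∑ i, p.1 i ^ 2) ^ (M + 1)) p := dψ.pow _
  have n4 : DifferentiableAt ℝ (fun p : E4 => ((M:ℝ) + 2) * (Z p * ∑ i, p.1 i ^ 2) ^ (M + 1)) p :=
    n3.const_mul _
  have n5 := n4.fun_mul dψj
  have n6 : DifferentiableAt ℝ (fun _ : E4 => σ * (eb j).2) p := differentiableAt_const _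
  rw [dd_add (n2.fun_sub n5) n6, dd_sub n2 n5, dd_const, dd_sum n1, dd_mul n4 dψj, dd_cmul n3,
    dd_pow dψ M]
  have e : ∀ k, dd (eb i) (fun p => 2 * dd (eb k) U p * dd (eb j) (dd (eb k) U) p) p =
      2 * (dd (eb i) (dd (eb k) U) p * dd (eb j) (dd (eb k) U) p
        + dd (eb k) U p * dd (eb i) (dd (eb j) (dd (eb k) U)) p) := by
    intro k
    rw [dd_mul (n0 k) (dUj k), dd_cmul (dU k)]; ring
  rw [Finset.sum_congr rfl fun k _ => e k, ← Finset.mul_sum]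
  ring

lemma pde_d {O : Set E4} (hO : IsOpen O) {U : E4 → ℝ} (hU : Sm O U)
    (hw : ∀ p ∈ O, 0 < 1 - ∑ k, dd (eb k) U p ^ 2)
    (hPDE : ∀ p ∈ O, dd et U p = U p ^ 2 * (∑ i, dd (eb i) (dd (eb i) U) p
      + (∑ i, ∑ j, dd (eb i) U p * dd (eb j) U p * dd (eb i) (dd (eb j) U) p)
        / (1 - ∑ k, dd (eb k) U p ^ 2)) - 3 * U p)
    {p : E4} (hp : p ∈ O) (k : Fin 3) :
    dd et (dd (eb k) U) p =
      2 * U p * dd (eb k) U p * (∑ i, dd (eb i) (dd (eb i) U) p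
      + (∑ i, ∑ j, dd (eb i) U p * dd (eb j) U p * dd (eb i) (dd (eb j) U) p)
        / (1 - ∑ k, dd (eb k) U p ^ 2))
      + U p ^ 2 * (∑ i, dd (eb i) (dd (eb i) (dd (eb k) U)) p
      + ((∑ i, ∑ j, (dd (eb k) (dd (eb i) U) p * dd (eb j) U p * dd (eb i) (dd (eb j) U) p
          + dd (eb i) U p * dd (eb k) (dd (eb j) U) p * dd (eb i) (dd (eb j) U) p
          + dd (eb i) U p * dd (eb j) U p * dd (eb i) (dd (eb j) (dd (eb k) U)) p))
            * (1 - ∑ k, dd (eb k) U p ^ 2)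
        - (∑ i, ∑ j, dd (eb i) U p * dd (eb j) U p * dd (eb i) (dd (eb j) U) p)
          * (- ∑ l, 2 * dd (eb l) U p * dd (eb k) (dd (eb l) U) p))
          / (1 - ∑ k, dd (eb k) U p ^ 2) ^ 2) - 3 * dd (eb k) U p := by
  rw [dd_comm hO hU hp, dd_congr hO hPDE hp]
  have T : ∀ i j, dd (eb i) (dd (eb j) (dd (eb k) U)) p
      = dd (eb k) (dd (eb i) (dd (eb j) U)) p := by
    intro i j
    rw [dd_comm hO (hU.dd hO (eb j)) hp (eb k) (eb i)]
    exact dd_congr hO (fun q hq => dd_comm hO hU hq _ _) hp _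
  simp only [T]
  have d0 := hU.diff hO hp
  have d1 : ∀ i, DifferentiableAt ℝ (dd (eb i) U) p := fun i => (hU.dd hO _).diff hO hp
  have d2 : ∀ i j, DifferentiableAt ℝ (dd (eb i) (dd (eb j) U)) p :=
    fun i j => ((hU.dd hO _).dd hO _).diff hO hp
  have s1 : DifferentiableAt ℝ (fun p => ∑ i, dd (eb i) (dd (eb i) U) p) p := by fun_prop
  have s2a : ∀ i j, DifferentiableAt ℝ (fun p => dd (eb i) U p * dd (eb j) U p) p :=
    fun i j => (d1 i).mul (d1 j)
  have s2b : ∀ i j, DifferentiableAt ℝ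
    (fun p => dd (eb i) U p * dd (eb j) U p * dd (eb i) (dd (eb j) U) p) p :=
    fun i j => (s2a i j).mul (d2 i j)
  have s2c : ∀ i, DifferentiableAt ℝ
    (fun p => ∑ j, dd (eb i) U p * dd (eb j) U p * dd (eb i) (dd (eb j) U) p) p := by
    intro i; fun_prop
  have s2 : DifferentiableAt ℝ
    (fun p => ∑ i, ∑ j, dd (eb i) U p * dd (eb j) U p * dd (eb i) (dd (eb j) U) p) p := by
    fun_prop
  have s3a : ∀ i, DifferentiableAt ℝ (fun p => dd (eb i) U p ^ 2) p := fun i => (d1 i).pow 2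
  have s3b : DifferentiableAt ℝ (fun p => ∑ i, dd (eb i) U p ^ 2) p := by fun_prop
  have c1 : DifferentiableAt ℝ (fun _ : E4 => (1:ℝ)) p := differentiableAt_const _
  have s3 : DifferentiableAt ℝ (fun p => 1 - ∑ i, dd (eb i) U p ^ 2) p := c1.sub s3b
  have w0 := (hw p hp).ne'
  have s4 : DifferentiableAt ℝ
    (fun p => (∑ i, ∑ j, dd (eb i) U p * dd (eb j) U p * dd (eb i) (dd (eb j) U) p)
      / (1 - ∑ i, dd (eb i) U p ^ 2)) p := by
    simp only [div_eq_mul_inv]; exact s2.mul (s3.inv w0)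
  have s5 := s1.fun_add s4
  have s6 : DifferentiableAt ℝ (fun p => U p ^ 2) p := d0.pow 2
  rw [dd_sub (s6.fun_mul s5) (d0.const_mul 3), dd_cmul d0, dd_mul s6 s5, dd_pow d0 1, dd_add s1 s4,
    dd_div s2 s3 w0, dd_sub c1 s3b, dd_const, dd_sum s3a, dd_sum (fun i => d2 i i), dd_sum s2c]
  have e1 : ∀ i, dd (eb k) (fun p => dd (eb i) U p ^ 2) p
      = 2 * dd (eb i) U p * dd (eb k) (dd (eb i) U) p := by
    intro i; rw [dd_pow (d1 i) 1]; norm_num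
  have e2 : ∀ i, dd (eb k) (fun p => ∑ j, dd (eb i) U p * dd (eb j) U p
      * dd (eb i) (dd (eb j) U) p) p = ∑ j, (dd (eb k) (dd (eb i) U) p * dd (eb j) U p
      * dd (eb i) (dd (eb j) U) p + dd (eb i) U p * dd (eb k) (dd (eb j) U) p
      * dd (eb i) (dd (eb j) U) p + dd (eb i) U p * dd (eb j) U p
      * dd (eb k) (dd (eb i) (dd (eb j) U)) p) := by
    intro i
    rw [dd_sum (s2b i)]
    refine Finset.sum_congr rfl fun j _ => ?_
    rw [dd_mul (s2a i j) (d2 i j), dd_mul (d1 i) (d1 j)]; ring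
  simp only [e1, e2]
  norm_num

lemma core {O : Set E4} (hO : IsOpen O) {U Z : E4 → ℝ} (hU : Sm O U) (hZ : Sm O Z)
    (hUpos : ∀ p ∈ O, 0 < U p) {α : ℝ}
    (hZd : ∀ e, ∀ p ∈ O, dd e Z p = -α * Z p * dd e U p / U p)
    (hw : ∀ p ∈ O, 0 < 1 - ∑ k, dd (eb k) U p ^ 2)
    (hPDE : ∀ p ∈ O, dd et U p = U p ^ 2 * (∑ i, dd (eb i) (dd (eb i) U) p
      + (∑ i, ∑ j, dd (eb i) U p * dd (eb j) U p * dd (eb i) (dd (eb j) U) p)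
        / (1 - ∑ k, dd (eb k) U p ^ 2)) - 3 * U p)
    {p : E4} (hp : p ∈ O) (κ μ σ lam : ℝ) (M : ℕ) (hZp : 0 < Z p)
    (hκ : 0 < κ) (hκ1 : κ ≤ 1) (hκw : κ ≤ 1 - ∑ k, dd (eb k) U p ^ 2) (hα : 0 < α) (hα1 : α ≤ 1)
    (hlam : 0 < lam) (hlam1 : lam ≤ 1)
    (hψ1 : Z p * ∑ i, p.1 i ^ 2 ≤ 1) (hμ : U p ^ 2 * Z p ≤ μ)
    (hmax : ∀ᶠ q in 𝓝 p, q.2 ≤ p.2 →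
      ∑ k, dd (eb k) U q ^ 2 - (Z q * ∑ i, q.1 i ^ 2) ^ (M + 2) + σ * q.2 ≤
      ∑ k, dd (eb k) U p ^ 2 - (Z p * ∑ i, p.1 i ^ 2) ^ (M + 2) + σ * p.2) :
    6 * (∑ k, dd (eb k) U p ^ 2) * (1 - ∑ k, dd (eb k) U p ^ 2) ≤
      σ + lam + 5 * (M + 2) ^ 2 * (10 * (α + μ)) / (κ ^ 2 * lam) := by
  have sG : Sm O (fun p => ∑ k, dd (eb k) U p ^ 2 - (Z p * ∑ i, p.1 i ^ 2) ^ (M + 2)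
      + σ * p.2) := by
    have a1 : ∀ k, ContDiffOn ℝ (⊤ : ℕ∞) (dd (eb k) U) O := fun k => hU.dd hO _
    have a2 : ContDiffOn ℝ (⊤ : ℕ∞) (fun p : E4 => Z p * ∑ i, p.1 i ^ 2) O :=
      hZ.mul (Sm.rho O)
    have a3 : ContDiffOn ℝ (⊤ : ℕ∞) (fun p : E4 => σ * p.2) O :=
      ContDiff.contDiffOn (by fun_prop)
    exact ((ContDiffOn.sum fun k _ => (a1 k).pow 2).sub (a2.pow _)).add a3
  refine alg_main (fun k => dd (eb k) U p) p.1
    (fun i => dd (eb i) (fun p => Z p * ∑ i, p.1 i ^ 2) p) (fun k => dd et (dd (eb k) U) p)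
    (fun i j => dd (eb i) (dd (eb j) U) p)
    (fun i j => dd (eb i) (dd (eb j) (fun p => Z p * ∑ i, p.1 i ^ 2)) p)
    (fun i j k => dd (eb i) (dd (eb j) (dd (eb k) U)) p) (U p) _ _ (dd et U p) (Z p) α _ _ κ μ σ
    lam M (hUpos p hp) hZp hκ hκ1 hκw hα hα1 hlam hlam1 (fun i j => dd_comm hO hU hp _ _) rfl rfl
    rfl rfl hψ1 hμ (hPDE p hp) (fun k => pde_d hO hU hw hPDE hp k)
    (fun i => psi_d1 hO hZ hZd hp i) (fun i j => psi_d2 hO hU hZ hUpos hZd hp i j)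
    ?_ ?_ ?_
  · intro j
    have h := (second_test hO sG hp (eb j) rfl hmax).1
    rw [G_d1 hO hU hZ σ M hp] at h
    have : (eb j).2 = 0 := rfl
    rw [this] at h
    linarith
  · intro c
    have h := (second_test hO sG hp (sv c) rfl hmax).2
    rw [dd_sv2 hO sG hp] at h
    simp only [G_d2 hO hU hZ σ M hp] at h
    exact h
  · have h := time_test (sG.diff hO hp) hmax
    rw [G_d1 hO hU hZ σ M hp, psi_dt hO hZ hZd hp] at h
    have : et.2 = 1 := rfl
    rw [this, mul_one] at h
    exact h

end Core

section Fin

open Real Filter Topology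

lemma pd_slice {F : E4 → ℝ} {p : E4} (hF : DifferentiableAt ℝ F p) (i : Fin 3) :
    pd (fun y => F (y, p.2)) p.1 i = dd (eb i) F p := by
  unfold pd dd
  have h1 : HasFDerivAt (fun y : V3 => ((y, p.2) : E4)) (ContinuousLinearMap.inl ℝ V3 ℝ) p.1 :=
    hasFDerivAt_prodMk_left p.1 p.2
  have h2 : HasFDerivAt F (fderiv ℝ F p) (p.1, p.2) := hF.hasFDerivAt
  have h3 := h2.comp p.1 h1
  have h4 : fderiv ℝ (fun y => F (y, p.2)) p.1 =
    (fderiv ℝ F p).comp (ContinuousLinearMap.inl ℝ V3 ℝ) := h3.fderiv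
  rw [h4]
  simp [eb]

lemma deriv_slice {F : E4 → ℝ} {p : E4} (hF : DifferentiableAt ℝ F p) :
    deriv (fun r => F (p.1, r)) p.2 = dd et F p := by
  unfold dd
  have h1 : HasDerivAt (fun r : ℝ => ((p.1, r) : E4)) et p.2 :=
    (hasDerivAt_const p.2 p.1).prodMk (hasDerivAt_id p.2)
  have h2 : HasFDerivAt F (fderiv ℝ F p) (p.1, p.2) := hF.hasFDerivAt
  exact (h2.comp_hasDerivAt p.2 h1).deriv

lemma pde_alg (d : Fin 3 → ℝ) (h : Fin 3 → Fin 3 → ℝ) (U w : ℝ) (hU : 0 < U) (hw : 0 < w)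
    (hws : w = 1 - U ^ 2 * ∑ k, d k ^ 2) :
    -U * (∑ i, ∑ j, U ^ 2 * (kd i j + U ^ 2 * d i * d j / w) *
      (h i j + 1 / U ^ 2 * kd i j - 2 * d i * d j)) =
    U ^ 2 * (∑ i, U * (d i * d i - h i i) + (∑ i, ∑ j, (-U * d i) * (-U * d j)
      * (U * (d i * d j - h i j))) / w) - 3 * U := by
  obtain ⟨s, hs⟩ : ∃ s, s = ∑ k, d k ^ 2 := ⟨_, rfl⟩
  obtain ⟨t, ht⟩ : ∃ t, t = ∑ k, h k k := ⟨_, rfl⟩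
  obtain ⟨N, hN⟩ : ∃ N, N = ∑ i, ∑ j, d i * d j * h i j := ⟨_, rfl⟩
  have e1 : (∑ i, ∑ j, U ^ 2 * (kd i j + U ^ 2 * d i * d j / w) *
      (h i j + 1 / U ^ 2 * kd i j - 2 * d i * d j)) =
      U ^ 2 * ((t + 3 / U ^ 2 - 2 * s) + U ^ 2 / w * (N + s / U ^ 2 - 2 * s ^ 2)) := by
    rw [hs, ht, hN]
    simp only [Fin.sum_univ_three, kd]
    simp
    ring
  have e2 : ∑ i, U * (d i * d i - h i i) = U * (s - t) := by
    rw [hs, ht]; simp only [Fin.sum_univ_three]; ring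
  have e3 : (∑ i, ∑ j, (-U * d i) * (-U * d j) * (U * (d i * d j - h i j)))
      = U ^ 3 * (s ^ 2 - N) := by
    rw [hs, hN]; simp only [Fin.sum_univ_three]; ring
  rw [e1, e2, e3]
  have e4 : s = (1 - w) / U ^ 2 := by
    rw [← hs] at hws
    field_simp; linarith
  rw [e4]
  field_simp
  ring

/-- Parabolic domain. -/
def Om : Set E4 := {p | ∑ i, p.1 i ^ 2 < 1 ∧ 0 < p.2}

lemma Om_open : IsOpen Om := by
  unfold Om
  apply IsOpen.and
  · exact isOpen_lt (by fun_prop) continuous_const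
  · exact isOpen_lt continuous_const continuous_snd

section
variable {u : V3 → ℝ → ℝ}

lemma sm_u (h : ContDiffOn ℝ (⊤ : ℕ∞) (fun p : V3 × ℝ => u p.1 p.2)
    {p : V3 × ℝ | (∑ i, p.1 i ^ 2) < 1 ∧ 0 ≤ p.2}) : Sm Om (fun p => u p.1 p.2) :=
  h.mono fun _ hp => ⟨hp.1, hp.2.le⟩

lemma pd_u (h : Sm Om (fun p => u p.1 p.2)) {p : E4} (hp : p ∈ Om) (i : Fin 3) :
    pd (tslice u p.2) p.1 i = dd (eb i) (fun p => u p.1 p.2) p :=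
  pd_slice (F := fun p => u p.1 p.2) (h.diff Om_open hp) i

lemma pd2_u (h : Sm Om (fun p => u p.1 p.2)) {p : E4} (hp : p ∈ Om) (i j : Fin 3) :
    pd2 (tslice u p.2) p.1 i j = dd (eb i) (dd (eb j) (fun p => u p.1 p.2)) p := by
  unfold pd2
  rw [← pd_slice ((h.dd Om_open (eb j)).diff Om_open hp) i]
  unfold pd
  rw [Filter.EventuallyEq.fderiv_eq]
  have hc : Tendsto (fun y : V3 => ((y, p.2) : E4)) (𝓝 p.1) (𝓝 p) := by
    have : Continuous (fun y : V3 => ((y, p.2) : E4)) := by fun_prop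
    exact this.tendsto p.1
  filter_upwards [hc.eventually (Om_open.mem_nhds hp)] with y hy
  have hy' : ((y, p.2) : E4) ∈ Om := hy
  exact pd_u h hy' j

lemma U_d1 (h : Sm Om (fun p => u p.1 p.2)) {p : E4} (hp : p ∈ Om) (e : E4) :
    dd e (fun p => exp (-u p.1 p.2)) p
      = -exp (-u p.1 p.2) * dd e (fun p => u p.1 p.2) p := by
  have d0 := h.diff Om_open hp
  rw [dd_exp (F := fun p => -u p.1 p.2) d0.neg]
  have : dd e (fun p => -u p.1 p.2) p = - dd e (fun p => u p.1 p.2) p := by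
    have := dd_cmul d0 (-1) e
    simpa using this
  rw [this]; ring

lemma U_d2 (h : Sm Om (fun p => u p.1 p.2)) {p : E4} (hp : p ∈ Om) (i j : Fin 3) :
    dd (eb i) (dd (eb j) (fun p => exp (-u p.1 p.2))) p
      = exp (-u p.1 p.2) * (dd (eb i) (fun p => u p.1 p.2) p * dd (eb j) (fun p => u p.1 p.2) p
        - dd (eb i) (dd (eb j) (fun p => u p.1 p.2)) p) := by
  rw [dd_congr Om_open (fun q hq => U_d1 h hq (eb j)) hp]
  have d0 := h.diff Om_open hp
  have d1 := (h.dd Om_open (eb j)).diff Om_open hp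
  have d2 : DifferentiableAt ℝ (fun p : E4 => exp (-u p.1 p.2)) p := d0.neg.exp
  have d3 : DifferentiableAt ℝ (fun p : E4 => -exp (-u p.1 p.2)) p := d2.neg
  have e1 : dd (eb i) (fun p => -exp (-u p.1 p.2)) p
      = - dd (eb i) (fun p => exp (-u p.1 p.2)) p := by
    have := dd_cmul d2 (-1) (eb i)
    simpa using this
  rw [dd_mul d3 d1, e1, U_d1 h hp]; ring

lemma Z_d1 (h : Sm Om (fun p => u p.1 p.2)) (α : ℝ) (e : E4) (p : E4) (hp : p ∈ Om) :
    dd e (fun p => exp (α * u p.1 p.2)) p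
      = -α * exp (α * u p.1 p.2) * dd e (fun p => exp (-u p.1 p.2)) p / exp (-u p.1 p.2) := by
  have d0 := h.diff Om_open hp
  rw [U_d1 h hp, dd_exp (F := fun p => α * u p.1 p.2) (d0.const_mul α), dd_cmul d0]
  field_simp

lemma w_eq (h : Sm Om (fun p => u p.1 p.2)) {p : E4} (hp : p ∈ Om) :
    wfun (tslice u p.2) p.1 = 1 - ∑ k, dd (eb k) (fun p => exp (-u p.1 p.2)) p ^ 2 := by
  unfold wfun
  simp only [pd_u h hp, U_d1 h hp]
  rw [Finset.mul_sum]
  congr 1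
  refine Finset.sum_congr rfl fun i _ => ?_
  have : exp (-2 * tslice u p.2 p.1) = exp (-u p.1 p.2) ^ 2 := by
    rw [← exp_nat_mul]; congr 1; simp only [tslice]; push_cast; ring
  rw [this]; ring

lemma pde_U (h : Sm Om (fun p => u p.1 p.2)) {p : E4} (hp : p ∈ Om)
    (hw : 0 < wfun (tslice u p.2) p.1) (hf : FlowEq u p.1 p.2) :
    dd et (fun p => exp (-u p.1 p.2)) p = exp (-u p.1 p.2) ^ 2 *
      (∑ i, dd (eb i) (dd (eb i) (fun p => exp (-u p.1 p.2))) p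
      + (∑ i, ∑ j, dd (eb i) (fun p => exp (-u p.1 p.2)) p
          * dd (eb j) (fun p => exp (-u p.1 p.2)) p
          * dd (eb i) (dd (eb j) (fun p => exp (-u p.1 p.2))) p)
        / (1 - ∑ k, dd (eb k) (fun p => exp (-u p.1 p.2)) p ^ 2)) - 3 * exp (-u p.1 p.2) := by
  have d0 := h.diff Om_open hp
  have hds := deriv_slice d0
  unfold FlowEq at hf
  have hds' : deriv (fun r => u p.1 r) p.2 = dd et (fun p => u p.1 p.2) p := hds
  rw [hds'] at hf
  have hwe := w_eq h hp
  rw [← hwe, U_d1 h hp, hf]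
  have A := pde_alg (fun k => dd (eb k) (fun p => u p.1 p.2) p)
    (fun i j => dd (eb i) (dd (eb j) (fun p => u p.1 p.2)) p) (exp (-u p.1 p.2))
    (wfun (tslice u p.2) p.1) (exp_pos _) hw (by
      rw [hwe, Finset.mul_sum]
      congr 1
      refine Finset.sum_congr rfl fun i _ => ?_
      rw [U_d1 h hp]; ring)
  simp only [U_d2 h hp, U_d1 h hp, hInv, pd_u h hp, pd2_u h hp]
  have e1 : exp (-2 * tslice u p.2 p.1) = exp (-u p.1 p.2) ^ 2 := by
    rw [← exp_nat_mul]; congr 1; simp only [tslice]; push_cast; ring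
  have e2 : exp (2 * u p.1 p.2) = 1 / exp (-u p.1 p.2) ^ 2 := by
    rw [← exp_nat_mul, one_div, ← exp_neg]; congr 1; push_cast; ring
  rw [e1, e2]
  exact A

end

end Fin

section Main

open Real Filter Topology

lemma w_ge_of_inv {w C : ℝ} (hw : 0 < w) (hC : 1 ≤ C) (h : (Real.sqrt w)⁻¹ ≤ C) :
    1 / C ^ 2 ≤ w := by
  have hs : 0 < Real.sqrt w := Real.sqrt_pos.mpr hw
  have h1 : 1 ≤ C * Real.sqrt w := by
    rw [inv_le_iff_one_le_mul₀ hs] at h; linarith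
  have h2 : 1 ≤ (C * Real.sqrt w) ^ 2 := one_le_pow₀ h1
  rw [mul_pow, Real.sq_sqrt hw.le] at h2
  rw [div_le_iff₀ (by positivity)]; linarith

lemma inv_le_of_w {w θ : ℝ} (hw : 0 < w) (hθ : 0 < θ) (hθ1 : θ < 1) (h : 1 - w ≤ θ / 2) :
    (Real.sqrt w)⁻¹ ≤ 1 + θ := by
  have hs : 0 < Real.sqrt w := Real.sqrt_pos.mpr hw
  rw [inv_le_iff_one_le_mul₀ hs]
  have h2 : 1 ≤ (Real.sqrt w * (1 + θ)) ^ 2 := by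
    rw [mul_pow, Real.sq_sqrt hw.le]
    have : (1 - θ / 2) * (1 + θ) ^ 2 ≤ w * (1 + θ) ^ 2 := by gcongr; linarith
    nlinarith [mul_pos hθ hθ, mul_pos hθ (sub_pos.mpr hθ1), mul_pos (mul_pos hθ hθ) (sub_pos.mpr hθ1)]
  have h3 := (one_le_sq_iff₀ (by positivity)).mp h2
  linarith

lemma main_est (θ κ a σ δ : ℝ) (M : ℕ) (hθ : 0 < θ) (hθ1 : θ < 1) (hκ : 0 < κ) (hκ1 : κ ≤ 1)
    (ha : a = θ / 4) (hM : θ ^ (M + 2) ≤ a) (hσ : σ = a * κ)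
    (hδ : δ = a ^ 2 * κ ^ 4 / (100 * (M + 2) ^ 2)) (hδ1 : δ < 1)
    (u : V3 → ℝ → ℝ) (h : Sm Om (fun p => u p.1 p.2))
    (hsp : ∀ p ∈ Om, 0 < wfun (tslice u p.2) p.1)
    (hf : ∀ p ∈ Om, FlowEq u p.1 p.2)
    (hb : ∀ p ∈ Om, exp (δ * u p.1 p.2) * (∑ i, p.1 i ^ 2) ≤ 1 →
      -log δ ≤ u p.1 p.2 ∧ κ ≤ wfun (tslice u p.2) p.1)
    (p₀ : E4) (hp₀ : p₀ ∈ Om) (hS : 1 / σ + 1 ≤ p₀.2)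
    (hψ₀ : exp (δ * u p₀.1 p₀.2) * (∑ i, p₀.1 i ^ 2) ≤ θ) :
    1 - wfun (tslice u p₀.2) p₀.1 ≤ θ / 2 := by
  by_contra hcon
  push Not at hcon
  have ha0 : 0 < a := by rw [ha]; linarith
  have hσ0 : 0 < σ := by rw [hσ]; positivity
  have hδ0 : 0 < δ := by rw [hδ]; positivity
  have hlog : 0 < -log δ := by have := Real.log_neg hδ0 hδ1; linarith
  obtain ⟨U, hU⟩ : ∃ U : E4 → ℝ, U = fun p => exp (-u p.1 p.2) := ⟨_, rfl⟩
  obtain ⟨Z, hZ⟩ : ∃ Z : E4 → ℝ, Z = fun p => exp (δ * u p.1 p.2) := ⟨_, rfl⟩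
  have hZp : ∀ p, 0 < Z p := fun p => by rw [hZ]; exact exp_pos _
  have sU : Sm Om U := by rw [hU]; exact ContDiffOn.exp (ContDiffOn.neg h)
  have sZ : Sm Om Z := by rw [hZ]; exact ContDiffOn.exp (contDiffOn_const.mul h)
  have hwe : ∀ p ∈ Om, wfun (tslice u p.2) p.1 = 1 - ∑ k, dd (eb k) U p ^ 2 := by
    rw [hU]; exact fun p hp => w_eq h hp
  obtain ⟨q, hq⟩ : ∃ q : E4 → ℝ, q = fun p => ∑ k, dd (eb k) U p ^ 2 := ⟨_, rfl⟩
  obtain ⟨ψ, hψ⟩ : ∃ ψ : E4 → ℝ, ψ = fun p => Z p * ∑ i, p.1 i ^ 2 := ⟨_, rfl⟩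
  obtain ⟨G, hG⟩ : ∃ G : E4 → ℝ, G = fun p => q p - ψ p ^ (M + 2) + σ * p.2 := ⟨_, rfl⟩
  have hq1 : ∀ p ∈ Om, q p < 1 := by
    intro p hp
    have := hsp p hp
    rw [hwe p hp] at this
    rw [hq]; simp only; linarith
  have hψ0 : ∀ p, 0 ≤ ψ p := fun p => by
    rw [hψ]; exact mul_nonneg (hZp p).le (Finset.sum_nonneg fun i _ => sq_nonneg _)
  have hb' : ∀ p ∈ Om, ψ p ≤ 1 → -log δ ≤ u p.1 p.2 ∧ κ ≤ 1 - q p := by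
    intro p hp h1
    have := hb p hp (by rw [hψ, hZ] at h1; exact h1)
    rw [hwe p hp] at this
    rw [hq]; exact this
  have cψ : ContinuousOn ψ Om := by
    rw [hψ]; exact ContDiffOn.continuousOn (sZ.mul (Sm.rho Om))
  have cq : ContinuousOn q Om := by
    rw [hq]
    exact continuousOn_finsetSum _ fun k _ => (ContDiffOn.continuousOn (sU.dd Om_open _)).pow 2
  have cG : ContinuousOn G Om := by
    rw [hG]
    exact (cq.sub (cψ.pow _)).add (Continuous.continuousOn (by fun_prop))
  -- the radius
  obtain ⟨r, hr⟩ : ∃ r, r = exp (δ * log δ) := ⟨_, rfl⟩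
  have hr1 : r < 1 := by
    rw [hr, Real.exp_lt_one_iff]; nlinarith
  have hρ : ∀ p ∈ Om, ψ p ≤ 1 → ∑ i, p.1 i ^ 2 ≤ r := by
    intro p hp h1
    have h2 := (hb' p hp h1).1
    have h3 : ∑ i, p.1 i ^ 2 = ψ p * exp (-(δ * u p.1 p.2)) := by
      rw [hψ, hZ, exp_neg]; simp only
      field_simp
    rw [h3]
    have h4 : exp (-(δ * u p.1 p.2)) ≤ r := by
      rw [hr]; apply exp_le_exp.mpr; nlinarith
    calc ψ p * exp (-(δ * u p.1 p.2)) ≤ 1 * r :=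
          mul_le_mul h1 h4 (exp_pos _).le zero_le_one
      _ = r := one_mul r
  obtain ⟨B, hB⟩ : ∃ B : Set E4, B = {p | ∑ i, p.1 i ^ 2 ≤ r ∧ p.2 ∈ Set.Icc (p₀.2 - 1 / σ) p₀.2} :=
    ⟨_, rfl⟩
  have hBc : IsCompact B := by
    have hsub : B ⊆ (Set.Icc (fun _ => -1) (fun _ => 1) : Set V3) ×ˢ Set.Icc (p₀.2 - 1 / σ) p₀.2 := by
      rw [hB]
      rintro p ⟨h1, h2⟩
      refine ⟨?_, h2⟩
      have h3 : ∀ i, p.1 i ^ 2 ≤ 1 := fun i => by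
        have := Finset.single_le_sum (f := fun i => p.1 i ^ 2) (fun i _ => sq_nonneg _)
          (Finset.mem_univ i)
        linarith
      exact ⟨fun i => (abs_le.mp ((sq_le_one_iff_abs_le_one _).mp (h3 i))).1,
        fun i => (abs_le.mp ((sq_le_one_iff_abs_le_one _).mp (h3 i))).2⟩
    refine (isCompact_Icc.prod isCompact_Icc).of_isClosed_subset ?_ hsub
    rw [hB]
    apply IsClosed.and
    · exact isClosed_le (by fun_prop) continuous_const
    · exact isClosed_Icc.preimage continuous_snd
  have hBO : B ⊆ Om := by
    rw [hB]
    rintro p ⟨h1, h2, h3⟩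
    exact ⟨lt_of_le_of_lt h1 hr1, by linarith⟩
  have hKc : IsCompact (B ∩ ψ ⁻¹' Set.Iic 1) := by
    refine hBc.of_isClosed_subset ?_ Set.inter_subset_left
    exact (cψ.mono hBO).preimage_isClosed_of_isClosed hBc.isClosed isClosed_Iic
  have hψθ : ψ p₀ ≤ θ := by rw [hψ, hZ]; exact hψ₀
  have hστ : 0 < 1 / σ := by positivity
  have hp₀K : p₀ ∈ B ∩ ψ ⁻¹' Set.Iic 1 := by
    refine ⟨?_, ?_⟩
    · rw [hB]; exact ⟨hρ p₀ hp₀ (by linarith), by linarith, le_rfl⟩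
    · show ψ p₀ ≤ 1
      linarith
  obtain ⟨p, ⟨hpB, hpψ⟩, hmax⟩ := hKc.exists_isMaxOn ⟨p₀, hp₀K⟩
    (cG.mono (Set.inter_subset_left.trans hBO))
  have hpψ : ψ p ≤ 1 := hpψ
  have hpO := hBO hpB
  have hG0 : a + σ * p₀.2 < G p₀ := by
    rw [hwe p₀ hp₀] at hcon
    have h1 : θ / 2 < q p₀ := by rw [hq]; simp only; linarith
    have h2 : ψ p₀ ^ (M + 2) ≤ θ ^ (M + 2) := pow_le_pow_left₀ (hψ0 _) hψθ _
    rw [hG]; simp only; linarith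
  have hGp : a + σ * p₀.2 < G p := lt_of_lt_of_le hG0 (hmax hp₀K)
  have hGp' : a + σ * p₀.2 < q p - ψ p ^ (M + 2) + σ * p.2 := by rw [hG] at hGp; exact hGp
  have hpB' : ∑ i, p.1 i ^ 2 ≤ r ∧ p.2 ∈ Set.Icc (p₀.2 - 1 / σ) p₀.2 := by rw [hB] at hpB; exact hpB
  obtain ⟨-, hp2, hp3⟩ := hpB'
  have hσp : σ * p.2 ≤ σ * p₀.2 := by gcongr
  have hqp := hq1 p hpO
  have hψp : 0 ≤ ψ p ^ (M + 2) := pow_nonneg (hψ0 p) _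
  have hψlt : ψ p < 1 := by
    refine lt_of_le_of_ne hpψ fun h1 => ?_
    rw [h1, one_pow] at hGp'
    linarith
  have hplt : p₀.2 - 1 / σ < p.2 := by
    refine lt_of_le_of_ne hp2 fun h1 => ?_
    rw [← h1] at hGp'
    have : σ * (p₀.2 - 1 / σ) = σ * p₀.2 - 1 := by field_simp
    linarith
  have hqa : a < q p := by linarith
  obtain ⟨hup, hκp⟩ := hb' p hpO hpψ
  have hev : ∀ᶠ z in 𝓝 p, z.2 ≤ p.2 → G z ≤ G p := by
    have e1 : ∀ᶠ z in 𝓝 p, ψ z < 1 :=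
      (cψ.continuousAt (Om_open.mem_nhds hpO)).eventually (gt_mem_nhds hψlt)
    have e2 : ∀ᶠ z : E4 in 𝓝 p, p₀.2 - 1 / σ < z.2 :=
      continuous_snd.continuousAt.eventually (lt_mem_nhds hplt)
    filter_upwards [e1, e2, Om_open.mem_nhds hpO] with z h1 h2 h3 h4
    refine hmax ⟨?_, ?_⟩
    · rw [hB]; exact ⟨hρ z h3 h1.le, h2.le, h4.trans hp3⟩
    · exact h1.le
  have hμ : U p ^ 2 * Z p ≤ δ := by
    have : U p ^ 2 * Z p = exp ((δ - 2) * u p.1 p.2) := by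
      rw [hU, hZ]; simp only
      rw [← exp_nat_mul, ← exp_add]; congr 1; push_cast; ring
    rw [this, ← Real.le_log_iff_exp_le hδ0]
    nlinarith
  have hfin := core Om_open sU sZ (fun z _ => by rw [hU]; exact exp_pos _) (α := δ)
    (fun e z hz => by rw [hU, hZ]; exact Z_d1 h δ e z hz)
    (fun z hz => by rw [← hwe z hz]; exact hsp z hz)
    (fun z hz => by rw [hU]; exact pde_U h hz (hsp z hz) (hf z hz))
    hpO κ δ σ σ M (hZp p) hκ hκ1 (by rw [hq] at hκp; exact hκp) hδ0 hδ1.le hσ0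
    (by rw [hσ]; nlinarith) (by rw [hψ] at hpψ; exact hpψ) hμ
    (by rw [hG, hψ, hq] at hev; exact hev)
  have hfin' : 6 * q p * (1 - q p) ≤
      σ + σ + 5 * (M + 2) ^ 2 * (10 * (δ + δ)) / (κ ^ 2 * σ) := by rw [hq]; exact hfin
  have hc : 5 * ((M : ℝ) + 2) ^ 2 * (10 * (δ + δ)) / (κ ^ 2 * σ) = a * κ := by
    rw [hδ, hσ]; field_simp; ring
  rw [hc, hσ] at hfin'
  have : a * κ ≤ q p * (1 - q p) := mul_le_mul hqa.le hκp hκ.le (by linarith)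
  have : 0 < a * κ := by positivity
  nlinarith

end Main


open Real Filter in
/-- Flatness estimate: for every `C < ∞` and `θ ∈ (0,1)` there are `T₁`, `s₁` and
`α ∈ (0,1)` such that for any mean convex graphical MCF on `B₁ × [0,∞)` with
`u ≥ T₁` and `v ≤ C` wherever `e^{αu}|x|² ≤ 1`, one has `v(x,s) ≤ 1 + θ` for every
`s ≥ s₁` and every `x` with `e^{αu(x,s)}|x|² ≤ θ`. -/
theorem deSitter_flatness_estimate :
    ∀ C θ : ℝ, θ ∈ Set.Ioo (0 : ℝ) 1 →
      ∃ T₁ s₁ α : ℝ, α ∈ Set.Ioo (0 : ℝ) 1 ∧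
        ∀ u : V3 → ℝ → ℝ,
          ContDiffOn ℝ (⊤ : ℕ∞) (fun p : V3 × ℝ => u p.1 p.2)
            {p : V3 × ℝ | (∑ i, p.1 i ^ 2) < 1 ∧ 0 ≤ p.2} →
          (∀ x s, (∑ i, x i ^ 2) < 1 → 0 ≤ s → Spacelike (tslice u s) x) →
          (∀ x s, (∑ i, x i ^ 2) < 1 → 0 ≤ s → FlowEq u x s) →
          (∀ x s, (∑ i, x i ^ 2) < 1 → 0 ≤ s → 0 ≤ mcH (tslice u s) x) →
          (∀ x s, (∑ i, x i ^ 2) < 1 → 0 ≤ s →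
            exp (α * u x s) * (∑ i, x i ^ 2) ≤ 1 →
            T₁ ≤ u x s ∧ gradFun (tslice u s) x ≤ C) →
          ∀ s, s₁ ≤ s → 0 ≤ s → ∀ x, (∑ i, x i ^ 2) < 1 →
            exp (α * u x s) * (∑ i, x i ^ 2) ≤ θ →
            gradFun (tslice u s) x ≤ 1 + θ := by
  intro C θ hθ
  obtain ⟨hθ0, hθ1⟩ := hθ
  obtain ⟨D, hD⟩ : ∃ D, D = max C 1 := ⟨_, rfl⟩
  have hD1 : 1 ≤ D := by rw [hD]; exact le_max_right _ _
  have hCD : C ≤ D := by rw [hD]; exact le_max_left _ _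
  obtain ⟨κ, hκ⟩ : ∃ κ, κ = 1 / D ^ 2 := ⟨_, rfl⟩
  have hκ0 : 0 < κ := by rw [hκ]; positivity
  have hκ1 : κ ≤ 1 := by
    rw [hκ, div_le_one (by positivity)]; exact one_le_pow₀ hD1
  obtain ⟨a, ha⟩ : ∃ a, a = θ / 4 := ⟨_, rfl⟩
  have ha0 : 0 < a := by rw [ha]; linarith
  obtain ⟨M, hM0⟩ := exists_pow_lt_of_lt_one ha0 hθ1
  have hM : θ ^ (M + 2) ≤ a :=
    (pow_le_pow_of_le_one hθ0.le hθ1.le (by omega)).trans hM0.le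
  obtain ⟨δ, hδ⟩ : ∃ δ, δ = a ^ 2 * κ ^ 4 / (100 * ((M : ℝ) + 2) ^ 2) := ⟨_, rfl⟩
  have hδ0 : 0 < δ := by rw [hδ]; positivity
  have hδ1 : δ < 1 := by
    rw [hδ, div_lt_one (by positivity)]
    have h1 : a ^ 2 ≤ 1 := pow_le_one₀ ha0.le (by linarith)
    have h2 : κ ^ 4 ≤ 1 := pow_le_one₀ hκ0.le hκ1
    have h3 : a ^ 2 * κ ^ 4 ≤ 1 := mul_le_one₀ h1 (by positivity) h2
    have h4 : (0 : ℝ) ≤ M := Nat.cast_nonneg M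
    nlinarith
  refine ⟨-Real.log δ, 1 / (a * κ) + 1, δ, ⟨hδ0, hδ1⟩, ?_⟩
  intro u hu hsp hf _ hb s hs hs0 x hx hψ
  have hspos : 0 < s := by
    have : 0 < 1 / (a * κ) := by positivity
    linarith
  have hwpos : ∀ p ∈ Om, 0 < wfun (tslice u p.2) p.1 := by
    intro p hp
    have := hsp p.1 p.2 hp.1 hp.2.le
    unfold Spacelike at this
    unfold wfun
    linarith
  have hp₀ : ((x, s) : E4) ∈ Om := ⟨hx, hspos⟩
  refine inv_le_of_w (hwpos _ hp₀) hθ0 hθ1 ?_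
  refine main_est θ κ a (a * κ) δ M hθ0 hθ1 hκ0 hκ1 ha hM rfl hδ hδ1 u (sm_u hu) hwpos
    (fun p hp => hf p.1 p.2 hp.1 hp.2.le) ?_ (x, s) hp₀ hs hψ
  intro p hp h1
  obtain ⟨h2, h3⟩ := hb p.1 p.2 hp.1 hp.2.le h1
  refine ⟨h2, ?_⟩
  rw [hκ]
  exact w_ge_of_inv (hwpos p hp) hD1 (h3.trans hCD)
end

section
/- For every ε > 0 and every α ∈ (0,2) there exists T = T(α,ε) < ∞ such that for any spacelike graph u in de Sitter space, at every point x with u(x) ≥ T the function r := e^{α u}|x|² satisfies the two-sided gradient bound α²(1−ε) r² (v² − 1) − ε r v² ≤ |∇_M r|² ≤ 2α² r² (v² − 1) + ε r v². -/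
open Real Filter in
lemma pd_cut (u : V3 → ℝ) (hu : Differentiable ℝ u) (α : ℝ) (x : V3) (i : Fin 3) :
    pd (fun y => exp (α * u y) * ∑ j, y j ^ 2) x i =
      exp (α * u x) * (α * (∑ j, x j ^ 2) * pd u x i + 2 * x i) := by
  have h1 : HasFDerivAt (fun y => exp (α * u y)) (exp (α * u x) • (α • fderiv ℝ u x)) x :=
    ((hu x).hasFDerivAt.const_mul α).exp
  have h2 : HasFDerivAt (fun y : V3 => ∑ j, y j ^ 2)
      (∑ j, ((2 : ℕ) • x j ^ (2 - 1)) • (ContinuousLinearMap.proj j : V3 →L[ℝ] ℝ)) x := by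
    apply HasFDerivAt.fun_sum
    intro j _
    exact (hasFDerivAt_apply j x).pow 2
  have h3 := (h1.mul h2).fderiv
  unfold pd
  change fderiv ℝ ((fun y => exp (α * u y)) * (fun y : V3 => ∑ j, y j ^ 2)) x _ = _
  rw [h3]
  simp [Pi.single_apply]
  ring

/-- Expansion of the quadratic form `h^{ij} y_i y_j`. -/
lemma hInv_quad (u : V3 → ℝ) (x y : V3) :
    ∑ i, ∑ j, hInv u x i j * y i * y j =
      Real.exp (-2 * u x) * (∑ i, y i ^ 2 +
        Real.exp (-2 * u x) * (∑ i, pd u x i * y i) ^ 2 / wfun u x) := by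
  simp only [hInv, kd, Fin.sum_univ_three]
  simp
  ring

lemma alg_bound (ε α E R S B C q V c : ℝ) (hε : 0 < ε) (hR : 0 ≤ R)
    (hE : 0 < E) (hV : 0 ≤ V) (hC0 : 0 ≤ C)
    (hform : ∀ a b : ℝ, 0 ≤ a ^ 2 * S + 2 * a * b * B + b ^ 2 * C)
    (hC : C ≤ q * R * V) (hc : c = E * q) (hc1 : 8 * c ≤ ε) (hc2 : 4 * c ≤ ε ^ 2) :
    α ^ 2 * (1 - ε) * (E * R) ^ 2 * S - ε * (E * R) * V ≤
      E ^ 2 * (α ^ 2 * R ^ 2 * S + 4 * α * R * B + 4 * C) ∧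
    E ^ 2 * (α ^ 2 * R ^ 2 * S + 4 * α * R * B + 4 * C) ≤
      2 * α ^ 2 * (E * R) ^ 2 * S + ε * (E * R) * V := by
  have hX : 0 ≤ E * R * V := by positivity
  have hEC : E ^ 2 * C ≤ c * (E * R * V) := by
    have := mul_le_mul_of_nonneg_left hC (sq_nonneg E)
    rw [hc]; linarith
  have hEC0 : 0 ≤ E ^ 2 * C := by positivity
  constructor
  · have h1 := mul_nonneg (sq_nonneg E) (hform (ε * (α * R)) 2)
    have h2 := mul_le_mul_of_nonneg_right hc2 hX
    have h3 : 0 ≤ ε * (E ^ 2 * C) := by positivity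
    have key : 0 ≤ ε * (E ^ 2 * (α ^ 2 * R ^ 2 * S + 4 * α * R * B + 4 * C) -
        (α ^ 2 * (1 - ε) * (E * R) ^ 2 * S - ε * (E * R) * V)) := by
      linarith
    have := nonneg_of_mul_nonneg_right key hε
    linarith
  · have h1 := mul_nonneg (sq_nonneg E) (hform (α * R) (-2))
    have h2 := mul_le_mul_of_nonneg_right hc1 hX
    linarith

open Real Filter in
/-- Two sided bound for `|∇_M r|²` with `r = e^{αu}|x|²`:
`α²(1−ε)r²(v²−1) − εrv² ≤ |∇_M r|² ≤ 2α²r²(v²−1) + εrv²` wherever `u ≥ T`. -/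
theorem cutoff_gradient_bound :
    ∀ ε : ℝ, 0 < ε → ∀ α ∈ Set.Ioo (0 : ℝ) 2, ∃ T : ℝ,
      ∀ u : V3 → ℝ,
        ContDiff ℝ (⊤ : ℕ∞) u →
        (∀ x, Spacelike u x) →
        ∀ x, T ≤ u x →
          α ^ 2 * (1 - ε) * (exp (α * u x) * ∑ i, x i ^ 2) ^ 2 * ((gradFun u x) ^ 2 - 1)
              - ε * (exp (α * u x) * ∑ i, x i ^ 2) * (gradFun u x) ^ 2 ≤
            gradSq u (fun y => exp (α * u y) * ∑ i, y i ^ 2) x ∧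
          gradSq u (fun y => exp (α * u y) * ∑ i, y i ^ 2) x ≤
            2 * α ^ 2 * (exp (α * u x) * ∑ i, x i ^ 2) ^ 2 * ((gradFun u x) ^ 2 - 1)
              + ε * (exp (α * u x) * ∑ i, x i ^ 2) * (gradFun u x) ^ 2 := by
  intro ε hε α hα
  obtain ⟨hα0, hα2⟩ := hα
  set m : ℝ := min (ε / 8) (ε ^ 2 / 4) with hm
  have hmpos : 0 < m := by positivity
  refine ⟨Real.log m / (α - 2), ?_⟩
  intro u hu hsp x hx
  have hdiff : Differentiable ℝ u := hu.differentiable (by simp)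
  have hw : 0 < wfun u x := by
    have := hsp x
    unfold Spacelike at this
    unfold wfun
    linarith
  have hv : gradFun u x ^ 2 = (wfun u x)⁻¹ := by
    unfold gradFun
    rw [inv_pow, Real.sq_sqrt hw.le]
  have hc : exp (α * u x) * exp (-2 * u x) ≤ m := by
    rw [← Real.exp_add, ← Real.le_log_iff_exp_le hmpos]
    rw [div_le_iff_of_neg (by linarith)] at hx
    linarith
  have hc1 : exp (α * u x) * exp (-2 * u x) ≤ ε / 8 := hc.trans (min_le_left _ _)
  have hc2 : exp (α * u x) * exp (-2 * u x) ≤ ε ^ 2 / 4 := hc.trans (min_le_right _ _)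
  have hg : gradSq u (fun y => exp (α * u y) * ∑ i, y i ^ 2) x =
      ∑ i, ∑ j, hInv u x i j *
        (exp (α * u x) * (α * (∑ j, x j ^ 2) * pd u x i + 2 * x i)) *
        (exp (α * u x) * (α * (∑ j, x j ^ 2) * pd u x j + 2 * x j)) := by
    unfold gradSq gradPair
    simp only [pd_cut u hdiff]
  have hq := hInv_quad u x
    (fun i => exp (α * u x) * (α * (∑ j, x j ^ 2) * pd u x i + 2 * x i))
  rw [hg, hq, hv]
  have hR : 0 ≤ ∑ i, x i ^ 2 := Finset.sum_nonneg fun i _ => sq_nonneg _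
  have hwdef : wfun u x = 1 - exp (-2 * u x) * ∑ i, (pd u x i) ^ 2 := rfl
  have hCS := Finset.sum_mul_sq_le_sq_mul_sq Finset.univ (fun i => pd u x i) (fun i => x i)
  have hq0 : 0 < exp (-2 * u x) := Real.exp_pos _
  have hE : 0 < exp (α * u x) := Real.exp_pos _
  have e1 : ∀ a b : ℝ, ∑ i, (a * pd u x i + b * x i) ^ 2 = a ^ 2 * ∑ i, pd u x i ^ 2 +
      2 * a * b * ∑ i, pd u x i * x i + b ^ 2 * ∑ i, x i ^ 2 := by
    intro a b
    simp only [Fin.sum_univ_three]; ring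
  have e2 : ∀ a b : ℝ, ∑ i, pd u x i * (a * pd u x i + b * x i) =
      a * ∑ i, pd u x i ^ 2 + b * ∑ i, pd u x i * x i := by
    intro a b
    simp only [Fin.sum_univ_three]; ring
  have e3 : ∀ i, exp (α * u x) * (α * (∑ j, x j ^ 2) * pd u x i + 2 * x i) =
      (exp (α * u x) * (α * (∑ j, x j ^ 2))) * pd u x i + (exp (α * u x) * 2) * x i := by
    intro i; ring
  simp only [e3, e1, e2]
  have e0 : ∀ a b : ℝ, 0 ≤ a ^ 2 * ∑ i, pd u x i ^ 2 +
      2 * a * b * ∑ i, pd u x i * x i + b ^ 2 * ∑ i, x i ^ 2 := by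
    intro a b
    rw [← e1]
    exact Finset.sum_nonneg fun i _ => sq_nonneg _
  generalize (∑ i, x i ^ 2) = R at *
  generalize (∑ i, pd u x i ^ 2) = P at *
  generalize (∑ i, pd u x i * x i) = D at *
  generalize exp (-2 * u x) = q at *
  generalize exp (α * u x) = E at *
  generalize wfun u x = w at *
  have hwi : 0 < w⁻¹ := inv_pos.mpr hw
  have hqP : q * P * w⁻¹ = w⁻¹ - 1 := by
    have : q * P = 1 - w := by linarith
    rw [this]; field_simp
  -- the quadratic form in the basis `Du, x`
  have hexp : ∀ a b : ℝ, q * ((a ^ 2 * P + 2 * a * b * D + b ^ 2 * R) +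
      q * (a * P + b * D) ^ 2 / w) =
      a ^ 2 * (w⁻¹ - 1) + 2 * a * b * (q * D * w⁻¹) + b ^ 2 * (q * (R + q * D ^ 2 * w⁻¹)) := by
    intro a b
    have : P * q = 1 - w := by linarith
    field_simp
    linear_combination (a ^ 2 * q * P + a ^ 2 + 2 * a * b * q * D) * this
  have hform : ∀ a b : ℝ, 0 ≤ a ^ 2 * (w⁻¹ - 1) + 2 * a * b * (q * D * w⁻¹) +
      b ^ 2 * (q * (R + q * D ^ 2 * w⁻¹)) := by
    intro a b
    rw [← hexp]
    have := e0 a b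
    positivity
  have hC : q * (R + q * D ^ 2 * w⁻¹) ≤ q * R * w⁻¹ := by
    have h1 : q * D ^ 2 * w⁻¹ ≤ q * (P * R) * w⁻¹ := by gcongr
    have h2 : q * (P * R) * w⁻¹ = R * (w⁻¹ - 1) := by rw [← hqP]; ring
    have h3 : R + q * D ^ 2 * w⁻¹ ≤ R * w⁻¹ := by linarith
    calc _ ≤ q * (R * w⁻¹) := by gcongr
      _ = _ := by ring
  have main := alg_bound ε α E R (w⁻¹ - 1) (q * D * w⁻¹) (q * (R + q * D ^ 2 * w⁻¹)) q w⁻¹ (E * q)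
    hε hR hE hwi.le (by positivity) hform hC rfl (by linarith) (by linarith)
  rw [hexp]
  have hfin : (E * (α * R)) ^ 2 * (w⁻¹ - 1) + 2 * (E * (α * R)) * (E * 2) * (q * D * w⁻¹) +
      (E * 2) ^ 2 * (q * (R + q * D ^ 2 * w⁻¹)) =
      E ^ 2 * (α ^ 2 * R ^ 2 * (w⁻¹ - 1) + 4 * α * R * (q * D * w⁻¹) +
        4 * (q * (R + q * D ^ 2 * w⁻¹))) := by ring
  rw [hfin]
  exact main
end

section
/- For any spacelike graph M = {(x,u(x))} in de Sitter space, the restriction of each ambient coordinate function x_k (k = 1,2,3) to M satisfies Δ_M x_k = (H − 2v) e^{−2u} v u_k. -/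
open Real in
theorem aux_wpos (u : V3 → ℝ) (hsp : ∀ x, Spacelike u x) (x : V3) : 0 < wfun u x := by
  have := hsp x
  unfold Spacelike at this
  unfold wfun
  linarith

open Real in
theorem aux_det (u : V3 → ℝ) (x : V3) : detH u x = (exp (u x)) ^ 6 * wfun u x := by
  have h1 : exp (2 * u x) = exp (u x) ^ 2 := by rw [← Real.exp_nat_mul]; norm_num
  have h2 : exp (-2 * u x) = (exp (u x) ^ 2)⁻¹ := by rw [← h1, ← Real.exp_neg]; ring_nf
  have hE : exp (u x) ≠ 0 := (Real.exp_pos _).ne'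
  unfold detH wfun
  rw [Matrix.det_fin_three, h2]
  simp only [Matrix.of_apply, hmet, kd, h1, Fin.sum_univ_three]
  simp
  field_simp
  ring

open Real in
theorem aux_pd_coord (x : V3) (k j : Fin 3) : pd (fun y => y k) x j = kd j k := by
  unfold pd kd
  have : HasFDerivAt (fun y : V3 => y k) (ContinuousLinearMap.proj (R := ℝ) (φ := fun _ : Fin 3 => ℝ) k) x :=
    (ContinuousLinearMap.proj (R := ℝ) (φ := fun _ : Fin 3 => ℝ) k).hasFDerivAt
  rw [this.fderiv]
  simp [Pi.single_apply, eq_comm]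

open Real in
theorem aux_flux (u : V3 → ℝ) (hsp : ∀ x, Spacelike u x) (k i : Fin 3) (y : V3) :
    Real.sqrt (detH u y) * ∑ j, hInv u y i j * pd (fun y => y k) y j =
      exp (u y) * Real.sqrt (wfun u y) * kd i k
        + exp (- u y) * (pd u y i * pd u y k) * (Real.sqrt (wfun u y))⁻¹ := by
  have hw := aux_wpos u hsp y
  have h1 : exp (-2 * u y) = (exp (u y) ^ 2)⁻¹ := by
    rw [← Real.exp_nat_mul, ← Real.exp_neg]; norm_num
  have hs : 0 < Real.sqrt (wfun u y) := Real.sqrt_pos.2 hw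
  have hE := Real.exp_pos (u y)
  have h3 : Real.sqrt (detH u y) = exp (u y) ^ 3 * Real.sqrt (wfun u y) := by
    rw [aux_det, Real.sqrt_mul (by positivity)]
    congr 1
    rw [show exp (u y) ^ 6 = (exp (u y) ^ 3) ^ 2 by ring, Real.sqrt_sq (by positivity)]
  have h4 : ∑ j, hInv u y i j * pd (fun y => y k) y j = hInv u y i k := by
    simp [aux_pd_coord, kd]
  rw [h4, h3]
  unfold hInv
  rw [h1, Real.exp_neg]
  have h5 : wfun u y = Real.sqrt (wfun u y) ^ 2 := (Real.sq_sqrt hw.le).symm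
  generalize hS : Real.sqrt (wfun u y) = s at *
  rw [h5]
  field_simp

open Real in
theorem aux_deriv (u : V3 → ℝ) (hsm : ContDiff ℝ (⊤ : ℕ∞) u) (hsp : ∀ x, Spacelike u x)
    (x : V3) (k i : Fin 3) :
    pd (fun y => exp (u y) * Real.sqrt (wfun u y) * kd i k
        + exp (- u y) * (pd u y i * pd u y k) * (Real.sqrt (wfun u y))⁻¹) x i =
    (fun E s W : ℝ =>
      (E * pd u x i * s + E * (W / (2 * s))) * kd i k
      + ((-(E⁻¹ * pd u x i) * (pd u x i * pd u x k)
        + E⁻¹ * (pd2 u x i i * pd u x k + pd u x i * pd2 u x i k)) * s⁻¹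
        - E⁻¹ * (pd u x i * pd u x k) * (W / (2 * s)) / s ^ 2)) (exp (u x)) (Real.sqrt (wfun u x))
      (exp (-2 * u x) * (2 * pd u x i * (∑ j, pd u x j ^ 2) - 2 * ∑ j, pd u x j * pd2 u x i j)) := by
  have hw := aux_wpos u hsp x
  have hs : Real.sqrt (wfun u x) ≠ 0 := (Real.sqrt_pos.2 hw).ne'
  have hu : HasFDerivAt u (fderiv ℝ u x) x :=
    (hsm.differentiable (by simp)).differentiableAt.hasFDerivAt
  have hp : ∀ j, HasFDerivAt (fun y => pd u y j) (fderiv ℝ (fun y => pd u y j) x) x := by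
    intro j
    have : ContDiff ℝ 1 (fun y => pd u y j) := by
      unfold pd
      exact ((contDiff_infty.1 hsm 2).fderiv_right (m := 1) (by norm_num)).clm_apply contDiff_const
    exact (this.differentiable (by simp)).differentiableAt.hasFDerivAt
  have hW : HasFDerivAt (wfun u) _ x :=
    ((hu.const_mul (-2)).exp.mul (HasFDerivAt.fun_sum (u := Finset.univ) (fun j _ => (hp j).pow 2))).const_sub 1
  have hS := hW.sqrt hw.ne'
  have hSi := (hasDerivAt_inv hs).comp_hasFDerivAt x hS
  have hF := ((hu.exp.mul hS).mul_const (kd i k)).add ((hu.neg.exp.mul ((hp i).mul (hp k))).mul hSi)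
  have key := hF.fderiv
  unfold pd at key ⊢
  erw [key]
  simp only [pd2, pd]
  simp only [Fin.sum_univ_three]
  simp [Real.exp_neg]
  field_simp
  ring

open Real in
theorem aux_symm (u : V3 → ℝ) (hsm : ContDiff ℝ (⊤ : ℕ∞) u) (x : V3) (i j : Fin 3) :
    pd2 u x i j = pd2 u x j i := by
  have hd : DifferentiableAt ℝ (fderiv ℝ u) x :=
    (((contDiff_infty.1 hsm 2).fderiv_right (m := 1) (by norm_num)).differentiable (by simp)).differentiableAt
  have h : ∀ i j, pd2 u x i j = fderiv ℝ (fderiv ℝ u) x (Pi.single i 1) (Pi.single j 1) := by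
    intro i j
    unfold pd2 pd
    rw [fderiv_clm_apply hd (by fun_prop)]
    simp
  rw [h, h]
  have : IsSymmSndFDerivAt ℝ u x := (contDiff_infty.1 hsm 2).contDiffAt.isSymmSndFDerivAt (by simp)
  exact this _ _

open Real in
/-- For a spacelike graph in de Sitter space,
`Δ_M x_k = (H − 2v) e^{−2u} v u_k` for each `k = 1,2,3`. -/
theorem laplacian_of_space_coordinates
    (u : V3 → ℝ) (hsm : ContDiff ℝ (⊤ : ℕ∞) u) (hsp : ∀ x, Spacelike u x)
    (x : V3) (k : Fin 3) :
    lapM u (fun y => y k) x =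
      (mcH u x - 2 * gradFun u x) * exp (-2 * u x) * gradFun u x * pd u x k := by
  have hw := aux_wpos u hsp x
  have hs : 0 < Real.sqrt (wfun u x) := Real.sqrt_pos.2 hw
  have hE := Real.exp_pos (u x)
  have h1 : exp (2 * u x) = exp (u x) ^ 2 := by rw [← Real.exp_nat_mul]; norm_num
  have h2 : exp (-2 * u x) = (exp (u x) ^ 2)⁻¹ := by rw [← h1, ← Real.exp_neg]; ring_nf
  have h3 : Real.sqrt (detH u x) = exp (u x) ^ 3 * Real.sqrt (wfun u x) := by
    rw [aux_det, Real.sqrt_mul (by positivity)]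
    congr 1
    rw [show exp (u x) ^ 6 = (exp (u x) ^ 3) ^ 2 by ring, Real.sqrt_sq (by positivity)]
  have h5 : wfun u x = Real.sqrt (wfun u x) ^ 2 := (Real.sq_sqrt hw.le).symm
  unfold lapM
  simp only [aux_flux u hsp k, aux_deriv u hsm hsp x k]
  have hT : ∑ j, pd u x j ^ 2 = exp (u x) ^ 2 * (1 - Real.sqrt (wfun u x) ^ 2) := by
    rw [← h5]; unfold wfun; rw [h2]; field_simp; ring
  unfold mcH hInv sff gradFun
  rw [h3, h1, h2, hT]
  generalize Real.sqrt (wfun u x) = s at *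
  rw [h5]
  generalize exp (u x) = E at *
  have hsy := aux_symm u hsm x
  generalize hp : pd u x = p at *
  generalize hP : pd2 u x = P at *
  have e1 : ∀ i, p i * p i = p i ^ 2 := fun i => by ring
  obtain ⟨L, hL⟩ : ∃ L, L = P 0 0 + P 1 1 + P 2 2 := ⟨_, rfl⟩
  obtain ⟨Q, hQ⟩ : ∃ Q, Q = ∑ i, ∑ j, p i * p j * P i j := ⟨_, rfl⟩
  obtain ⟨R, hR⟩ : ∃ R : Fin 3 → ℝ, ∀ i, R i = ∑ j, p j * P i j := ⟨_, fun _ => rfl⟩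
  have hQ2 : Q = p 0 * R 0 + p 1 * R 1 + p 2 * R 2 := by
    rw [hQ]; simp only [hR, Fin.sum_univ_three]; ring
  have hmain : (∑ i, ∑ j, (E ^ 2)⁻¹ * (kd i j + (E ^ 2)⁻¹ * p i * p j / s ^ 2) *
      (s⁻¹ * (P i j + E ^ 2 * kd i j - 2 * p i * p j))) =
      s⁻¹ * ((E ^ 2)⁻¹ * (L + 3 * E ^ 2 - 2 * (E ^ 2 * (1 - s ^ 2))) + (E ^ 2)⁻¹ * (E ^ 2)⁻¹ / s ^ 2 *
        (Q + E ^ 2 * (E ^ 2 * (1 - s ^ 2)) - 2 * (E ^ 2 * (1 - s ^ 2)) ^ 2)) := by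
    rw [← hT, hL, hQ]
    simp only [Fin.sum_univ_three, kd]
    simp
    ring
  rw [hmain]
  have hlhs : (∑ i, ((E * p i * s + E * ((E ^ 2)⁻¹ * (2 * p i * (E ^ 2 * (1 - s ^ 2)) - 2 * ∑ j, p j * P i j) / (2 * s))) * kd i k
      + ((-(E⁻¹ * p i) * (p i * p k)
        + E⁻¹ * (P i i * p k + p i * P i k)) * s⁻¹
        - E⁻¹ * (p i * p k) * ((E ^ 2)⁻¹ * (2 * p i * (E ^ 2 * (1 - s ^ 2)) - 2 * ∑ j, p j * P i j) / (2 * s)) / s ^ 2))) =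
      E * p k * s + E * ((E ^ 2)⁻¹ * (2 * p k * (E ^ 2 * (1 - s ^ 2)) - 2 * R k) / (2 * s))
      + E⁻¹ * s⁻¹ * (-(E ^ 2 * (1 - s ^ 2)) * p k + L * p k + R k)
      - E⁻¹ * p k * ((E ^ 2)⁻¹ * (2 * (E ^ 2 * (1 - s ^ 2)) ^ 2 - 2 * Q) / (2 * s)) / s ^ 2 := by
    have hRk : R k = ∑ j, p j * P j k := by
      rw [hR]; exact Finset.sum_congr rfl fun j _ => by rw [hsy]
    rw [Finset.sum_add_distrib]
    simp only [← hR]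
    have a1 : ∀ f : Fin 3 → ℝ, ∑ i, f i * kd i k = f k := by intro f; simp [kd]
    rw [a1, add_sub_assoc, add_right_inj, hQ2, hL, hRk, ← hT]
    simp only [Fin.sum_univ_three]
    ring
  rw [hlhs]
  field_simp
  ring
end

section
/- For any spacelike graph M = {(x,u(x))} in de Sitter space, the gradient function satisfies the identity |∇_M v|² = v²(v² − 1) − 2v A(∂_t^⊤, ∂_t^⊤) + |A(·, ∂_t^⊤)|². -/
lemma gog_pd_gradFun (u : V3 → ℝ) (hsm : ContDiff ℝ (⊤ : ℕ∞) u) (hsp : ∀ x, Spacelike u x)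
    (x : V3) (i : Fin 3) :
    pd (gradFun u) x i = (gradFun u x) ^ 3 * (Real.exp (-2 * u x) *
      ((∑ k, pd u x k * pd2 u x i k) - pd u x i * ∑ k, (pd u x k) ^ 2)) := by
  have hw : 0 < wfun u x := by
    have := hsp x
    unfold Spacelike at this
    unfold wfun
    linarith
  have hu : HasFDerivAt u (fderiv ℝ u x) x :=
    (hsm.differentiable (by simp)).differentiableAt.hasFDerivAt
  have hp : ∀ k, HasFDerivAt (fun y => pd u y k) (fderiv ℝ (fun y => pd u y k) x) x := by
    intro k
    have h1 : ContDiff ℝ (⊤ : ℕ∞) (fun y => pd u y k) := by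
      unfold pd
      exact (hsm.fderiv_right (m := (⊤ : ℕ∞)) (by simp)).clm_apply contDiff_const
    exact (h1.differentiable (by simp)).differentiableAt.hasFDerivAt
  have hs := HasFDerivAt.fun_sum (u := Finset.univ) (fun k _ => (hp k).pow 2)
  have hW := (((hu.const_mul (-2)).exp).mul hs).const_sub 1
  have hW' : HasFDerivAt (wfun u) _ x := hW
  have hsq := hW'.sqrt hw.ne'
  have hV := (hasDerivAt_inv (Real.sqrt_pos.2 hw).ne').comp_hasFDerivAt x hsq
  have hV' : HasFDerivAt (gradFun u) _ x := hV
  have e : pd (gradFun u) x i = _ := congrArg (fun L => L (Pi.single i 1)) hV'.fderiv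
  have h2 : ∀ k, fderiv ℝ (fun y => pd u y k) x (Pi.single i 1) = pd2 u x i k := fun _ => rfl
  have h1 : fderiv ℝ u x (Pi.single i 1) = pd u x i := rfl
  rw [e]
  simp [Fin.sum_univ_three, h1, h2, gradFun]
  have hq := (Real.sqrt_pos.2 hw).ne'
  field_simp
  ring

open Real in
/-- Gradient identity for the gradient function of a spacelike graph:
`|∇_M v|² = v²(v² − 1) − 2v A(∂_t^⊤, ∂_t^⊤) + |A(·, ∂_t^⊤)|²`. -/
theorem gradient_of_gradient_function
    (u : V3 → ℝ) (hsm : ContDiff ℝ (⊤ : ℕ∞) u) (hsp : ∀ x, Spacelike u x) (x : V3) :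
    gradSq u (gradFun u) x =
      (gradFun u x) ^ 2 * ((gradFun u x) ^ 2 - 1)
        - 2 * gradFun u x * Att u x + At2 u x := by
  have hw : 0 < wfun u x := by
    have := hsp x
    unfold Spacelike at this
    unfold wfun
    linarith
  have hv : (gradFun u x) ^ 2 = (wfun u x)⁻¹ := by
    unfold gradFun
    rw [inv_pow, Real.sq_sqrt hw.le]
  have hvw : (gradFun u x) ^ 2 * wfun u x = 1 := by
    rw [hv, inv_mul_cancel₀ hw.ne']
  have hE : Real.exp (-2 * u x) * Real.exp (2 * u x) = 1 := by
    rw [← Real.exp_add]; simp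
  have hwd : wfun u x = 1 - Real.exp (-2 * u x) *
      (pd u x 0 ^ 2 + pd u x 1 ^ 2 + pd u x 2 ^ 2) := by
    simp [wfun, Fin.sum_univ_three]
  have hP : ∀ k, Pvec u x k = Real.exp (-2 * u x) * pd u x k * (gradFun u x) ^ 2 := by
    intro k
    have h1 : Pvec u x k = Real.exp (-2 * u x) * (pd u x k + Real.exp (-2 * u x) * pd u x k *
        (pd u x 0 ^ 2 + pd u x 1 ^ 2 + pd u x 2 ^ 2) * (gradFun u x) ^ 2) := by
      rw [hv]
      fin_cases k <;> simp [Pvec, hInv, kd, Fin.sum_univ_three] <;> ring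
    rw [h1]
    rw [hwd] at hvw
    linear_combination (-Real.exp (-2 * u x) * pd u x k) * hvw
  have hA : ∀ m, ∑ k, sff u x m k * Pvec u x k
      = pd (gradFun u) x m + gradFun u x * pd u x m := by
    intro m
    rw [gog_pd_gradFun u hsm hsp]
    have h1 : ∑ k, sff u x m k * Pvec u x k = (gradFun u x) ^ 3 * (Real.exp (-2 * u x) *
        ((∑ k, pd u x k * pd2 u x m k) + Real.exp (2 * u x) * pd u x m
          - 2 * pd u x m * ∑ k, (pd u x k) ^ 2)) := by
      simp only [hP]
      fin_cases m <;> simp [sff, kd, Fin.sum_univ_three] <;> ring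
    rw [h1]
    rw [hwd] at hvw
    simp only [Fin.sum_univ_three]
    linear_combination (gradFun u x * pd u x m) * hvw + (gradFun u x ^ 3 * pd u x m) * hE
  have hAtt : Att u x = ∑ k, (pd (gradFun u) x k + gradFun u x * pd u x k) * Pvec u x k := by
    unfold Att
    refine Finset.sum_congr rfl fun k _ => ?_
    rw [← hA, Finset.sum_mul]
    exact Finset.sum_congr rfl fun l _ => by ring
  have hPu : ∑ k, pd u x k * Pvec u x k = gradFun u x ^ 2 - 1 := by
    simp only [hP, Fin.sum_univ_three]
    rw [hwd] at hvw
    linear_combination -hvw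
  have hsymm : ∀ i j, hInv u x i j = hInv u x j i := by
    intro i j
    simp only [hInv, kd, eq_comm (a := i)]
    ring
  have hAt2 : At2 u x = gradSq u (gradFun u) x
      + 2 * gradFun u x * (∑ k, pd (gradFun u) x k * Pvec u x k)
      + gradFun u x ^ 2 * ∑ k, pd u x k * Pvec u x k := by
    unfold At2 gradSq gradPair
    simp only [hA]
    simp only [Pvec, Fin.sum_univ_three]
    rw [hsymm 1 0, hsymm 2 0, hsymm 2 1]
    ring
  have hAtt' : Att u x = (∑ k, pd (gradFun u) x k * Pvec u x k)
      + gradFun u x * ∑ k, pd u x k * Pvec u x k := by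
    rw [hAtt]
    simp only [Fin.sum_univ_three]
    ring
  rw [hAt2, hAtt', hPu]
  ring
end

section
/- For any spacelike graph M = {(x,u(x))} in de Sitter space, the gradient function satisfies the identity Δ_M v = −H(v² + 1) + v³ + 2v + h^{ij} u_i ∂_j H + |A|² v − |A(·, ∂_t^⊤)|²/v + |∇_M v|²/v, where the term h^{ij} u_i ∂_j H equals −g(∂_t, ∇_M H) expressed in graph coordinates. -/
/-- `f` is differentiable at `x` with partial derivatives `d`. -/
def HP (f : V3 → ℝ) (x : V3) (d : Fin 3 → ℝ) : Prop :=
  DifferentiableAt ℝ f x ∧ ∀ i, pd f x i = d i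

theorem HP.congr {f : V3 → ℝ} {x : V3} {d d' : Fin 3 → ℝ} (h : HP f x d) (hd : ∀ i, d i = d' i) :
    HP f x d' := ⟨h.1, fun i => (h.2 i).trans (hd i)⟩

theorem HP.const (c : ℝ) (x : V3) : HP (fun _ => c) x (fun _ => 0) :=
  ⟨by fun_prop, fun i => by simp [pd]⟩

theorem HP.add {f g : V3 → ℝ} {x : V3} {d d' : Fin 3 → ℝ} (h : HP f x d) (h' : HP g x d') :
    HP (fun y => f y + g y) x (fun i => d i + d' i) :=
  ⟨h.1.add h'.1, fun i => by
    simp only [← h.2, ← h'.2]; unfold pd; rw [fderiv_fun_add h.1 h'.1]; rfl⟩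

theorem HP.sub {f g : V3 → ℝ} {x : V3} {d d' : Fin 3 → ℝ} (h : HP f x d) (h' : HP g x d') :
    HP (fun y => f y - g y) x (fun i => d i - d' i) :=
  ⟨h.1.sub h'.1, fun i => by
    simp only [← h.2, ← h'.2]; unfold pd; rw [fderiv_fun_sub h.1 h'.1]; rfl⟩

theorem HP.mul {f g : V3 → ℝ} {x : V3} {d d' : Fin 3 → ℝ} (h : HP f x d) (h' : HP g x d') :
    HP (fun y => f y * g y) x (fun i => d i * g x + f x * d' i) :=
  ⟨h.1.mul h'.1, fun i => by
    simp only [← h.2, ← h'.2]; unfold pd; rw [fderiv_fun_mul h.1 h'.1]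
    simp; ring⟩

/-- Chain rule with a function of one variable. -/
theorem HP.comp {f : V3 → ℝ} {x : V3} {d : Fin 3 → ℝ} {φ : ℝ → ℝ} {c : ℝ} (h : HP f x d)
    (hφ : HasDerivAt φ c (f x)) : HP (fun y => φ (f y)) x (fun i => c * d i) := by
  have := hφ.comp_hasFDerivAt x h.1.hasFDerivAt
  refine ⟨this.differentiableAt, fun i => ?_⟩
  have h2 : fderiv ℝ (fun y => φ (f y)) x = c • fderiv ℝ f x := this.fderiv
  simp only [← h.2]; unfold pd; rw [h2]; rfl

theorem HP.sum {f : Fin 3 → V3 → ℝ} {x : V3} {d : Fin 3 → Fin 3 → ℝ} (h : ∀ k, HP (f k) x (d k)) :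
    HP (fun y => ∑ k, f k y) x (fun i => ∑ k, d k i) := by
  simp only [Fin.sum_univ_three]
  exact ((h 0).add (h 1)).add (h 2)

theorem HP.of_contDiff {f : V3 → ℝ} (hf : ContDiff ℝ (⊤ : ℕ∞) f) (x : V3) :
    HP f x (fun i => pd f x i) :=
  ⟨(hf.differentiable (by simp)) x, fun _ => rfl⟩

theorem contDiff_pd {f : V3 → ℝ} (hf : ContDiff ℝ (⊤ : ℕ∞) f) (i : Fin 3) :
    ContDiff ℝ (⊤ : ℕ∞) (fun y => pd f y i) := by
  unfold pd
  exact (hf.fderiv_right (m := (⊤ : ℕ∞)) (by simp)).clm_apply contDiff_const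

theorem pd2_symm {f : V3 → ℝ} (hf : ContDiff ℝ (⊤ : ℕ∞) f) (x : V3) (i j : Fin 3) :
    pd2 f x i j = pd2 f x j i := by
  have hs : IsSymmSndFDerivAt ℝ f x :=
    hf.contDiffAt.isSymmSndFDerivAt (by
      simp only [minSmoothness_of_isRCLikeNormedField]
      exact WithTop.coe_le_coe.2 (le_top : (2 : ℕ∞) ≤ ⊤))
  have hd : DifferentiableAt ℝ (fderiv ℝ f) x :=
    ((hf.fderiv_right (m := (⊤ : ℕ∞)) (by simp)).differentiable (by simp)) x
  have key : ∀ a b : Fin 3, pd2 f x a b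
      = fderiv ℝ (fderiv ℝ f) x (Pi.single a 1) (Pi.single b 1) := by
    intro a b
    unfold pd2 pd
    rw [fderiv_clm_apply hd (by fun_prop)]
    simp
  rw [key, key]
  exact hs.eq _ _

/-- Third partial derivatives `∂_i ∂_j ∂_k u`. -/
noncomputable def pd3 (u : V3 → ℝ) (x : V3) (i j k : Fin 3) : ℝ := pd (fun y => pd2 u y j k) x i

theorem pd3_symm {u : V3 → ℝ} (hu : ContDiff ℝ (⊤ : ℕ∞) u) (x : V3) (i j k : Fin 3) :
    pd3 u x i j k = pd3 u x j i k :=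
  pd2_symm (contDiff_pd hu k) x i j

theorem pd3_symm' {u : V3 → ℝ} (hu : ContDiff ℝ (⊤ : ℕ∞) u) (x : V3) (i j k : Fin 3) :
    pd3 u x i j k = pd3 u x i k j := by
  unfold pd3
  congr 1
  funext y
  exact pd2_symm hu y j k

/-- Euclidean squared gradient. -/
noncomputable def sF (u : V3 → ℝ) (y : V3) : ℝ := ∑ k, pd u y k * pd u y k
/-- `u_{ik} u_k`. -/
noncomputable def qF (u : V3 → ℝ) (i : Fin 3) (y : V3) : ℝ := ∑ k, pd2 u y i k * pd u y k
/-- `u_{ik} u_i u_k`. -/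
noncomputable def QF (u : V3 → ℝ) (y : V3) : ℝ := ∑ i, qF u i y * pd u y i
/-- Euclidean Laplacian. -/
noncomputable def LF (u : V3 → ℝ) (y : V3) : ℝ := ∑ i, pd2 u y i i
/-- `e^{-2u}`. -/
noncomputable def eF (u : V3 → ℝ) (y : V3) : ℝ := Real.exp (-2 * u y)

section
variable {u : V3 → ℝ} (hu : ContDiff ℝ (⊤ : ℕ∞) u) (hsp : ∀ x, Spacelike u x) (x : V3)

theorem HP_pd (hu : ContDiff ℝ (⊤ : ℕ∞) u) (x : V3) (k : Fin 3) :
    HP (fun y => pd u y k) x (fun i => pd2 u x i k) :=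
  HP.of_contDiff (contDiff_pd hu k) x

theorem HP_pd2 (hu : ContDiff ℝ (⊤ : ℕ∞) u) (x : V3) (j k : Fin 3) :
    HP (fun y => pd2 u y j k) x (fun i => pd3 u x i j k) :=
  HP.of_contDiff (contDiff_pd (contDiff_pd hu k) j) x

theorem HP_s (hu : ContDiff ℝ (⊤ : ℕ∞) u) (x : V3) : HP (sF u) x (fun i => 2 * qF u i x) :=
  (HP.sum fun k => (HP_pd hu x k).mul (HP_pd hu x k)).congr fun i => by
    simp only [qF, Fin.sum_univ_three]; ring

theorem HP_q (hu : ContDiff ℝ (⊤ : ℕ∞) u) (x : V3) (j : Fin 3) :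
    HP (qF u j) x (fun i => ∑ k, (pd3 u x i j k * pd u x k + pd2 u x j k * pd2 u x i k)) :=
  HP.sum fun k => (HP_pd2 hu x j k).mul (HP_pd hu x k)

theorem HP_Q (hu : ContDiff ℝ (⊤ : ℕ∞) u) (x : V3) :
    HP (QF u) x (fun i => ∑ j, ((∑ k, (pd3 u x i j k * pd u x k + pd2 u x j k * pd2 u x i k))
      * pd u x j + qF u j x * pd2 u x i j)) :=
  HP.sum fun k => (HP_q hu x k).mul (HP_pd hu x k)

theorem HP_L (hu : ContDiff ℝ (⊤ : ℕ∞) u) (x : V3) :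
    HP (LF u) x (fun i => ∑ k, pd3 u x i k k) :=
  HP.sum fun k => HP_pd2 hu x k k

theorem HP_exp (hu : ContDiff ℝ (⊤ : ℕ∞) u) (x : V3) (c : ℝ) :
    HP (fun y => Real.exp (c * u y)) x (fun i => c * Real.exp (c * u x) * pd u x i) :=
  (((HP.const c x).mul (HP.of_contDiff hu x)).comp (Real.hasDerivAt_exp _)).congr fun i => by
    ring

theorem HP_e (hu : ContDiff ℝ (⊤ : ℕ∞) u) (x : V3) :
    HP (eF u) x (fun i => -2 * eF u x * pd u x i) := HP_exp hu x (-2)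

theorem wfun_eq (u : V3 → ℝ) (y : V3) : wfun u y = 1 - eF u y * sF u y := by
  unfold wfun eF sF
  simp only [pow_two]

theorem w_pos (hsp : ∀ x, Spacelike u x) (y : V3) : 0 < wfun u y := by
  have := hsp y
  unfold Spacelike at this
  unfold wfun
  linarith

theorem v_pos (hsp : ∀ x, Spacelike u x) (y : V3) : 0 < gradFun u y :=
  inv_pos.2 (Real.sqrt_pos.2 (w_pos hsp y))

theorem w_eq_v (hsp : ∀ x, Spacelike u x) (y : V3) : wfun u y = ((gradFun u y) ^ 2)⁻¹ := by
  unfold gradFun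
  rw [inv_pow, inv_inv, Real.sq_sqrt (w_pos hsp y).le]

theorem es_eq (hsp : ∀ x, Spacelike u x) (y : V3) :
    eF u y * sF u y = 1 - ((gradFun u y) ^ 2)⁻¹ := by
  have := wfun_eq u y
  rw [w_eq_v hsp y] at this
  linarith

theorem HP_v (hu : ContDiff ℝ (⊤ : ℕ∞) u) (hsp : ∀ x, Spacelike u x) (x : V3) :
    HP (gradFun u) x (fun i => (gradFun u x) ^ 3 * eF u x * (qF u i x - sF u x * pd u x i)) := by
  have hw := (HP.const 1 x).sub ((HP_e hu x).mul (HP_s hu x))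
  rw [show (fun y => 1 - eF u y * sF u y) = wfun u from funext fun y => (wfun_eq u y).symm] at hw
  have hp := w_pos hsp x
  have hs := Real.sqrt_pos.2 hp
  have := hw.comp (φ := fun t => (Real.sqrt t)⁻¹) ((Real.hasDerivAt_sqrt hp.ne').inv hs.ne')
  refine HP.congr this fun i => ?_
  unfold gradFun
  field_simp
  ring

theorem hInv_eq (hsp : ∀ x, Spacelike u x) (y : V3) (i j : Fin 3) : hInv u y i j =
    eF u y * (kd i j + eF u y * (gradFun u y) ^ 2 * pd u y i * pd u y j) := by
  unfold hInv
  rw [w_eq_v hsp]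
  change eF u y * (kd i j + eF u y * pd u y i * pd u y j / _) = _
  rw [div_inv_eq_mul]
  ring

theorem e_mul_E (u : V3 → ℝ) (y : V3) : Real.exp (2 * u y) = (eF u y)⁻¹ := by
  unfold eF; rw [← Real.exp_neg]; congr 1; ring

theorem e_pos (u : V3 → ℝ) (y : V3) : 0 < eF u y := Real.exp_pos _

theorem sqrt_det (hsp : ∀ x, Spacelike u x) (y : V3) :
    Real.sqrt (detH u y) = Real.exp (3 * u y) * (gradFun u y)⁻¹ := by
  have hd : detH u y = (Real.exp (3 * u y)) ^ 2 * wfun u y := by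
    have h3 : (Real.exp (3 * u y)) ^ 2 = ((eF u y)⁻¹) ^ 3 := by
      rw [← e_mul_E, ← Real.exp_nat_mul, ← Real.exp_nat_mul]; congr 1; push_cast; ring
    rw [h3, wfun_eq]
    unfold detH
    rw [Matrix.det_fin_three]
    have := (e_pos u y).ne'
    simp [hmet, kd, e_mul_E, sF, Fin.sum_univ_three]
    field_simp
    ring
  rw [hd, Real.sqrt_mul (sq_nonneg _), Real.sqrt_sq (Real.exp_pos _).le]
  unfold gradFun
  rw [inv_inv]

/-- Flux of the gradient of `v`, without the weight. -/
noncomputable def GF (u : V3 → ℝ) (i : Fin 3) (y : V3) : ℝ :=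
  qF u i y - sF u y * pd u y i
    + eF u y * (gradFun u y * gradFun u y) * (QF u y - sF u y * sF u y) * pd u y i

theorem hInv_mul (hsp : ∀ x, Spacelike u x) (y : V3) (i : Fin 3) (z : Fin 3 → ℝ) :
    ∑ j, hInv u y i j * z j =
      eF u y * (z i + eF u y * (gradFun u y) ^ 2 * pd u y i * ∑ j, pd u y j * z j) := by
  simp only [hInv_eq hsp]
  fin_cases i <;> simp [Fin.sum_univ_three, kd] <;> ring

theorem flux_eq (hu : ContDiff ℝ (⊤ : ℕ∞) u) (hsp : ∀ x, Spacelike u x) (i : Fin 3) :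
    (fun y => Real.sqrt (detH u y) * ∑ j, hInv u y i j * pd (gradFun u) y j) =
    fun y => Real.exp (-1 * u y) * (gradFun u y * gradFun u y) * GF u i y := by
  funext y
  rw [sqrt_det hsp, hInv_mul hsp]
  have hv := (v_pos hsp y).ne'
  have hq : ∑ j, pd u y j * pd (gradFun u) y j =
      (gradFun u y) ^ 3 * eF u y * (QF u y - sF u y * sF u y) := by
    simp only [(HP_v hu hsp y).2]
    simp only [QF, sF, Fin.sum_univ_three]
    ring
  rw [hq, (HP_v hu hsp y).2]
  have hE : Real.exp (3 * u y) * eF u y * eF u y = Real.exp (-1 * u y) := by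
    unfold eF; rw [← Real.exp_add, ← Real.exp_add]; congr 1; ring
  rw [← hE]
  unfold GF
  field_simp

/-- `|Du²·Du|²`. -/
noncomputable def RF (u : V3 → ℝ) (y : V3) : ℝ := ∑ i, qF u i y * qF u i y
/-- `|D²u|²`. -/
noncomputable def NF (u : V3 → ℝ) (y : V3) : ℝ := ∑ i, ∑ k, pd2 u y i k * pd2 u y i k
/-- `u_k u_{kii}`. -/
noncomputable def alF (u : V3 → ℝ) (y : V3) : ℝ := ∑ k, pd u y k * ∑ i, pd3 u y k i i
/-- `u_i u_j u_k u_{ijk}`. -/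
noncomputable def beF (u : V3 → ℝ) (y : V3) : ℝ :=
  ∑ i, ∑ j, ∑ k, pd3 u y i j k * pd u y i * pd u y j * pd u y k

theorem div_q (hu : ContDiff ℝ (⊤ : ℕ∞) u) (x : V3) :
    ∑ i, ∑ k, (pd3 u x i i k * pd u x k + pd2 u x i k * pd2 u x i k) = alF u x + NF u x := by
  have h : ∀ i k, pd3 u x i i k = pd3 u x k i i := fun i k => by
    rw [pd3_symm' hu, pd3_symm hu x k i i, pd3_symm' hu, pd3_symm' hu]
  rw [alF, NF]
  simp only [Fin.sum_univ_three]
  rw [h 0 1, h 0 2, h 1 0, h 1 2, h 2 0, h 2 1]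
  ring

/-- `∂_i (u_{jk} u_k)`. -/
noncomputable def AF (u : V3 → ℝ) (x : V3) (i j : Fin 3) : ℝ :=
  ∑ k, (pd3 u x i j k * pd u x k + pd2 u x j k * pd2 u x i k)

/-- `∂_i (u_{jk} u_j u_k)`. -/
noncomputable def BF (u : V3 → ℝ) (x : V3) (i : Fin 3) : ℝ :=
  ∑ j, (AF u x i j * pd u x j + qF u j x * pd2 u x i j)

theorem p_grad_Q (hu : ContDiff ℝ (⊤ : ℕ∞) u) (x : V3) :
    ∑ i, pd u x i * BF u x i = beF u x + 2 * RF u x := by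
  have h10 := pd2_symm hu x 1 0
  have h20 := pd2_symm hu x 2 0
  have h21 := pd2_symm hu x 2 1
  simp only [BF, AF, beF, RF, qF, Fin.sum_univ_three, h10, h20, h21]
  ring

theorem HP_q' (hu : ContDiff ℝ (⊤ : ℕ∞) u) (x : V3) (j : Fin 3) :
    HP (qF u j) x (fun i => AF u x i j) := HP_q hu x j

theorem HP_Q' (hu : ContDiff ℝ (⊤ : ℕ∞) u) (x : V3) :
    HP (QF u) x (fun i => BF u x i) := HP_Q hu x

/-- Partial derivatives of `v`. -/
noncomputable def vd (u : V3 → ℝ) (x : V3) (i : Fin 3) : ℝ :=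
  (gradFun u x) ^ 3 * eF u x * (qF u i x - sF u x * pd u x i)

theorem HP_v' (hu : ContDiff ℝ (⊤ : ℕ∞) u) (hsp : ∀ x, Spacelike u x) (x : V3) :
    HP (gradFun u) x (vd u x) := HP_v hu hsp x

theorem pd_flux (hu : ContDiff ℝ (⊤ : ℕ∞) u) (hsp : ∀ x, Spacelike u x) (x : V3) (i : Fin 3)
    {e v s Q : ℝ} (he : eF u x = e) (hv : gradFun u x = v) (hs : sF u x = s)
    (hQ : QF u x = Q) :
    pd (fun y => Real.exp (-1 * u y) * (gradFun u y * gradFun u y) * GF u i y) x i =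
    Real.exp (-1 * u x) * ((-pd u x i * v ^ 2 + 2 * v * (v ^ 3 * e * (qF u i x - s * pd u x i)))
        * (qF u i x - s * pd u x i + e * v ^ 2 * (Q - s ^ 2) * pd u x i)
      + v ^ 2 * (AF u x i i - 2 * qF u i x * pd u x i - s * pd2 u x i i
        + (-2 * e * pd u x i * v ^ 2 * (Q - s ^ 2)
            + e * 2 * v * (v ^ 3 * e * (qF u i x - s * pd u x i)) * (Q - s ^ 2)
            + e * v ^ 2 * (BF u x i - 4 * s * qF u i x)) * pd u x i
        + e * v ^ 2 * (Q - s ^ 2) * pd2 u x i i)) := by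
  have h := ((HP_exp hu x (-1)).mul ((HP_v' hu hsp x).mul (HP_v' hu hsp x))).mul
    (((HP_q' hu x i).sub ((HP_s hu x).mul (HP_pd hu x i))).add
      ((((HP_e hu x).mul ((HP_v' hu hsp x).mul (HP_v' hu hsp x))).mul
        ((HP_Q' hu x).sub ((HP_s hu x).mul (HP_s hu x)))).mul (HP_pd hu x i)))
  refine (h.2 i).trans ?_
  simp only [vd, he, hv, hs, hQ]
  ring

theorem lap_eq (hu : ContDiff ℝ (⊤ : ℕ∞) u) (hsp : ∀ x, Spacelike u x) (x : V3)
    {e v s Q R N L al be : ℝ} (he : eF u x = e) (hv : gradFun u x = v) (hs : sF u x = s)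
    (hQ : QF u x = Q) (hR : RF u x = R) (hN : NF u x = N) (hL : LF u x = L)
    (hal : alF u x = al) (hbe : beF u x = be) :
    lapM u (gradFun u) x = e ^ 2 * v * (-(Q - s ^ 2 + e * v ^ 2 * (Q - s ^ 2) * s) * v ^ 2
      + 2 * v * (v ^ 3 * e * (R - 2 * s * Q + s ^ 3 + e * v ^ 2 * (Q - s ^ 2) ^ 2))
      + v ^ 2 * (al + N - 2 * Q - s * L + (-2 * e * s * v ^ 2 * (Q - s ^ 2)
        + e * 2 * v * (v ^ 3 * e * (Q - s ^ 2)) * (Q - s ^ 2)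
        + e * v ^ 2 * (be + 2 * R - 4 * s * Q) + e * v ^ 2 * (Q - s ^ 2) * L))) := by
  have hE : (Real.exp (3 * u x))⁻¹ * Real.exp (-1 * u x) = e ^ 2 := by
    rw [← he]; unfold eF
    rw [← Real.exp_neg, ← Real.exp_add, ← Real.exp_nat_mul]; congr 1; push_cast; ring
  have hdq : ∑ i, AF u x i i = al + N := by rw [← hal, ← hN]; exact div_q hu x
  have hpQ := p_grad_Q hu x
  rw [hR, hbe] at hpQ
  unfold lapM
  simp only [flux_eq hu hsp, pd_flux hu hsp x _ he hv hs hQ]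
  rw [sqrt_det hsp, mul_inv, inv_inv, hv, ← Finset.mul_sum]
  rw [mul_mul_mul_comm, hE, mul_assoc (e ^ 2)]
  congr 1
  congr 1
  simp only [sF] at hs
  simp only [QF] at hQ
  simp only [RF] at hR
  simp only [LF] at hL
  simp only [Fin.sum_univ_three] at *
  linear_combination (-v ^ 2 * (-s + e * v ^ 2 * (Q - s ^ 2))
      + 2 * v ^ 4 * e * (s ^ 2 - e * v ^ 2 * (Q - s ^ 2) * s)
      + v ^ 2 * (-2 * e * v ^ 2 * (Q - s ^ 2) - 2 * e ^ 2 * v ^ 4 * (Q - s ^ 2) * s)) * hs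
    + (-v ^ 2 + 2 * v ^ 4 * e * (-2 * s + e * v ^ 2 * (Q - s ^ 2))
      + v ^ 2 * (-2 + 2 * e ^ 2 * v ^ 4 * (Q - s ^ 2) - 4 * e * v ^ 2 * s)) * hQ
    + 2 * v ^ 4 * e * hR + v ^ 2 * hdq + v ^ 2 * (-s + e * v ^ 2 * (Q - s ^ 2)) * hL
    + e * v ^ 4 * hpQ

theorem hInv_sum2 (hsp : ∀ x, Spacelike u x) (y : V3) (X Y : Fin 3 → ℝ) :
    ∑ i, ∑ j, hInv u y i j * X i * Y j =
      eF u y * (∑ i, X i * Y i + eF u y * (gradFun u y) ^ 2 *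
        (∑ i, pd u y i * X i) * (∑ j, pd u y j * Y j)) := by
  simp only [hInv_eq hsp]
  simp [Fin.sum_univ_three, kd]
  ring

theorem hInv_tr (hsp : ∀ x, Spacelike u x) (y : V3) (z : Fin 3 → Fin 3 → ℝ) :
    ∑ i, ∑ j, hInv u y i j * z i j =
      eF u y * (∑ i, z i i + eF u y * (gradFun u y) ^ 2 *
        ∑ i, ∑ j, pd u y i * pd u y j * z i j) := by
  simp only [hInv_eq hsp]
  simp [Fin.sum_univ_three, kd]
  ring

theorem mcH_eq (hsp : ∀ x, Spacelike u x) : mcH u = fun y =>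
    gradFun u y * (eF u y * LF u y + 3 - 2 * (eF u y * sF u y) + gradFun u y * gradFun u y *
      (eF u y * eF u y * QF u y + eF u y * sF u y - 2 * ((eF u y * sF u y) * (eF u y * sF u y)))) := by
  funext y
  unfold mcH
  rw [hInv_tr hsp]
  have he := (e_pos u y).ne'
  simp only [sff, e_mul_E, LF, sF, QF, qF]
  simp [Fin.sum_univ_three, kd]
  field_simp
  ring

theorem pH_eq (hu : ContDiff ℝ (⊤ : ℕ∞) u) (hsp : ∀ x, Spacelike u x) (x : V3)
    {e v s Q R N L al be : ℝ} (he : eF u x = e) (hv : gradFun u x = v) (hs : sF u x = s)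
    (hQ : QF u x = Q) (hR : RF u x = R) (hL : LF u x = L)
    (hal : alF u x = al) (hbe : beF u x = be) :
    ∑ i, pd u x i * pd (mcH u) x i =
      v ^ 3 * e * (Q - s ^ 2) * (e * L + 3 - 2 * (e * s) + v * v *
        (e * e * Q + e * s - 2 * ((e * s) * (e * s))))
      + v * ((-2 * e * s) * L + e * al - 2 * ((-2 * e * s) * s + e * (2 * Q))
        + 2 * v * (v ^ 3 * e * (Q - s ^ 2)) * (e * e * Q + e * s - 2 * ((e * s) * (e * s)))
        + v * v * (2 * e * (-2 * e * s) * Q + e * e * (be + 2 * R)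
          + ((-2 * e * s) * s + e * (2 * Q)) * (1 - 4 * (e * s)))) := by
  have hes := (HP_e hu x).mul (HP_s hu x)
  have hvv := (HP_v' hu hsp x).mul (HP_v' hu hsp x)
  have h := (HP_v' hu hsp x).mul
    (((((HP_e hu x).mul (HP_L hu x)).add (HP.const 3 x)).sub ((HP.const 2 x).mul hes)).add
      (hvv.mul (((((HP_e hu x).mul (HP_e hu x)).mul (HP_Q' hu x)).add hes).sub
        ((HP.const 2 x).mul (hes.mul hes)))))
  rw [← mcH_eq hsp] at h
  have hpQ := p_grad_Q hu x
  rw [hR, hbe] at hpQ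
  simp only [h.2, vd, he, hv, hs, hQ, hL]
  simp only [sF] at hs
  simp only [QF] at hQ
  simp only [alF] at hal
  generalize hM : (fun i => ∑ k, pd3 u x i k k) = M
  have hM' : ∀ i, ∑ k, pd3 u x i k k = M i := fun i => by rw [← hM]
  simp only [hM'] at *
  simp only [Fin.sum_univ_three] at *
  linear_combination
    (-(v ^ 3 * e * s) * (e * L + 3 - 2 * (e * s) + v * v *
        (e * e * Q + e * s - 2 * ((e * s) * (e * s))))
      + v * (-2 * e * L + 4 * e * s
        - 2 * v * (v ^ 3 * e * s) * (e * e * Q + e * s - 2 * ((e * s) * (e * s)))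
        + v * v * (-4 * e * e * Q - 2 * e * s * (1 - 4 * (e * s))))) * hs
    + (v ^ 3 * e * (e * L + 3 - 2 * (e * s) + v * v *
        (e * e * Q + e * s - 2 * ((e * s) * (e * s))))
      + v * (-4 * e
        + 2 * v * (v ^ 3 * e) * (e * e * Q + e * s - 2 * ((e * s) * (e * s)))
        + v * v * (2 * e * (1 - 4 * (e * s))))) * hQ
    + v * e * hal + v * v * v * e * e * hpQ

theorem normA2_alg (e V : ℝ) (p : Fin 3 → ℝ) (b : Fin 3 → Fin 3 → ℝ)
    (hb : ∀ i j, b i j = b j i) :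
    ∑ i, ∑ j, ∑ k, ∑ l, (e * (kd i k + e * V * p i * p k)) * (e * (kd j l + e * V * p j * p l))
      * b i j * b k l = e ^ 2 * (∑ i, ∑ j, b i j ^ 2 + 2 * e * V * ∑ i, (∑ j, b i j * p j) ^ 2
        + e ^ 2 * V ^ 2 * (∑ i, ∑ j, p i * p j * b i j) ^ 2) := by
  have h10 := hb 1 0
  have h20 := hb 2 0
  have h21 := hb 2 1
  simp [Fin.sum_univ_three, kd, h10, h20, h21]
  ring

theorem sff_symm (hu : ContDiff ℝ (⊤ : ℕ∞) u) (x : V3) (i j : Fin 3) :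
    sff u x i j = sff u x j i := by
  unfold sff
  rw [pd2_symm hu x i j]
  have : kd i j = kd j i := by unfold kd; simp only [eq_comm]
  rw [this]; ring

theorem sff_p (u : V3 → ℝ) (x : V3) (i : Fin 3) : ∑ j, sff u x i j * pd u x j =
    gradFun u x * (qF u i x + ((eF u x)⁻¹ - 2 * sF u x) * pd u x i) := by
  simp only [sff, e_mul_E, sF, qF]
  fin_cases i <;> simp [Fin.sum_univ_three, kd] <;> ring

theorem sum_sff_p_sq (u : V3 → ℝ) (x : V3) : ∑ i, (∑ j, sff u x i j * pd u x j) ^ 2 =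
    gradFun u x ^ 2 * (RF u x + ((eF u x)⁻¹ - 2 * sF u x) ^ 2 * sF u x
      + 2 * ((eF u x)⁻¹ - 2 * sF u x) * QF u x) := by
  simp only [sff_p]
  rw [RF, QF]
  generalize hk : (eF u x)⁻¹ - 2 * sF u x = k
  simp only [sF, Fin.sum_univ_three]
  ring

theorem sum_p_sff_p (u : V3 → ℝ) (x : V3) : ∑ i, pd u x i * (∑ j, sff u x i j * pd u x j) =
    gradFun u x * (QF u x + ((eF u x)⁻¹ - 2 * sF u x) * sF u x) := by
  simp only [sff_p]
  rw [QF]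
  generalize hk : (eF u x)⁻¹ - 2 * sF u x = k
  simp only [sF, Fin.sum_univ_three]
  ring

theorem normA2_eq (hu : ContDiff ℝ (⊤ : ℕ∞) u) (hsp : ∀ x, Spacelike u x) (x : V3)
    {e v s Q R N L : ℝ} (he : eF u x = e) (hv : gradFun u x = v) (hs : sF u x = s)
    (hQ : QF u x = Q) (hR : RF u x = R) (hN : NF u x = N) (hL : LF u x = L) :
    normA2 u x = v ^ 2 * e ^ 2 * (N + 3 * (e⁻¹) ^ 2 + 4 * s ^ 2 + 2 * e⁻¹ * L - 4 * Q
        - 4 * e⁻¹ * s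
      + 2 * e * v ^ 2 * (R + (e⁻¹ - 2 * s) ^ 2 * s + 2 * (e⁻¹ - 2 * s) * Q)
      + e ^ 2 * v ^ 4 * (Q + (e⁻¹ - 2 * s) * s) ^ 2) := by
  have h1 := sum_sff_p_sq u x
  have h2 := sum_p_sff_p u x
  have h2' : ∑ i, ∑ j, pd u x i * pd u x j * sff u x i j
      = ∑ i, pd u x i * (∑ j, sff u x i j * pd u x j) := by
    simp only [Fin.sum_univ_three]; ring
  have h3 : ∑ i, ∑ j, sff u x i j ^ 2 = v ^ 2 * (N + 3 * (e⁻¹) ^ 2 + 4 * s ^ 2 + 2 * e⁻¹ * L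
      - 4 * Q - 4 * e⁻¹ * s) := by
    rw [← hN, ← hs, ← hL, ← hQ, NF, LF, QF]
    simp only [sff, e_mul_E, he, hv, sF, qF]
    simp [Fin.sum_univ_three, kd]
    ring
  unfold normA2
  simp only [hInv_eq hsp]
  rw [normA2_alg _ _ _ _ (sff_symm hu x), h1, h2', h2, h3, he, hv, hs, hQ, hR]
  ring

theorem Pvec_eq (hsp : ∀ x, Spacelike u x) (x : V3) (k : Fin 3) :
    Pvec u x k = eF u x * gradFun u x ^ 2 * pd u x k := by
  unfold Pvec
  rw [hInv_mul hsp]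
  change eF u x * (pd u x k + eF u x * gradFun u x ^ 2 * pd u x k * sF u x) = _
  have h := es_eq hsp x
  have hv := (v_pos hsp x).ne'
  field_simp at h
  linear_combination eF u x * pd u x k * h

theorem At2_eq (hsp : ∀ x, Spacelike u x) (x : V3)
    {e v s Q R : ℝ} (he : eF u x = e) (hv : gradFun u x = v) (hs : sF u x = s)
    (hQ : QF u x = Q) (hR : RF u x = R) :
    At2 u x = v ^ 2 * (e * v ^ 2) ^ 2 * e *
      (R + (e⁻¹ - 2 * s) ^ 2 * s + 2 * (e⁻¹ - 2 * s) * Q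
        + e * v ^ 2 * (Q + (e⁻¹ - 2 * s) * s) ^ 2) := by
  have h1 := sum_sff_p_sq u x
  have h2 := sum_p_sff_p u x
  have h : ∀ m, ∑ k, sff u x m k * Pvec u x k = e * v ^ 2 * ∑ j, sff u x m j * pd u x j := by
    intro m
    rw [Finset.mul_sum]
    refine Finset.sum_congr rfl fun k _ => ?_
    rw [Pvec_eq hsp, he, hv]; ring
  unfold At2
  rw [hInv_sum2 hsp]
  simp only [h]
  rw [he, hv, hs, hQ, hR] at h1
  rw [he, hv, hs, hQ] at h2
  rw [he, hv]
  generalize (fun m => ∑ j, sff u x m j * pd u x j) = X at *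
  have e1 : ∀ X : Fin 3 → ℝ, ∑ i, e * v ^ 2 * X i * (e * v ^ 2 * X i)
      = (e * v ^ 2) ^ 2 * ∑ i, X i ^ 2 := fun X => by
    simp only [Fin.sum_univ_three]; ring
  have e2 : ∀ X : Fin 3 → ℝ, ∑ i, pd u x i * (e * v ^ 2 * X i)
      = (e * v ^ 2) * ∑ i, pd u x i * X i := fun X => by
    simp only [Fin.sum_univ_three]; ring
  rw [e1, e2, h1, h2]
  ring

theorem gradSq_eq (hu : ContDiff ℝ (⊤ : ℕ∞) u) (hsp : ∀ x, Spacelike u x) (x : V3)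
    {e v s Q R : ℝ} (he : eF u x = e) (hv : gradFun u x = v) (hs : sF u x = s)
    (hQ : QF u x = Q) (hR : RF u x = R) :
    gradSq u (gradFun u) x = e * ((v ^ 3 * e) ^ 2 * (R - 2 * s * Q + s ^ 3)
      + e * v ^ 2 * (v ^ 3 * e * (Q - s ^ 2)) ^ 2) := by
  unfold gradSq gradPair
  rw [hInv_sum2 hsp]
  simp only [(HP_v hu hsp x).2, he, hv, hs]
  have e1 : ∑ i, v ^ 3 * e * (qF u i x - s * pd u x i) * (v ^ 3 * e * (qF u i x - s * pd u x i))
      = (v ^ 3 * e) ^ 2 * (R - 2 * s * Q + s ^ 3) := by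
    simp only [sF] at hs
    simp only [QF] at hQ
    simp only [RF] at hR
    simp only [Fin.sum_univ_three] at *
    linear_combination (v ^ 3 * e) ^ 2 * (hR - 2 * s * hQ + s ^ 2 * hs)
  have e2 : ∑ i, pd u x i * (v ^ 3 * e * (qF u i x - s * pd u x i))
      = v ^ 3 * e * (Q - s ^ 2) := by
    simp only [sF] at hs
    simp only [QF] at hQ
    simp only [Fin.sum_univ_three] at *
    linear_combination (v ^ 3 * e) * (hQ - s * hs)
  rw [e1, e2]
  ring

theorem gradH_eq (hsp : ∀ x, Spacelike u x) (x : V3) (Y : Fin 3 → ℝ) :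
    ∑ i, ∑ j, hInv u x i j * pd u x i * Y j =
      eF u x * gradFun u x ^ 2 * ∑ i, pd u x i * Y i := by
  rw [hInv_sum2 hsp]
  change eF u x * (∑ i, pd u x i * Y i + eF u x * gradFun u x ^ 2 * sF u x * _) = _
  have h := es_eq hsp x
  have hv := (v_pos hsp x).ne'
  field_simp at h
  linear_combination eF u x * (∑ i, pd u x i * Y i) * h

end

open Real in
/-- Laplacian identity for the gradient function of a spacelike graph:
`Δ_M v = −H(v²+1) + v³ + 2v + h^{ij}u_i ∂_j H + |A|²v − |A(·,∂_t^⊤)|²/v + |∇_M v|²/v`. -/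
theorem laplacian_of_gradient_function
    (u : V3 → ℝ) (hsm : ContDiff ℝ (⊤ : ℕ∞) u) (hsp : ∀ x, Spacelike u x) (x : V3) :
    lapM u (gradFun u) x =
      -(mcH u x) * ((gradFun u x) ^ 2 + 1) + (gradFun u x) ^ 3 + 2 * gradFun u x
        + (∑ i, ∑ j, hInv u x i j * pd u x i * pd (mcH u) x j)
        + normA2 u x * gradFun u x
        - At2 u x / gradFun u x
        + gradSq u (gradFun u) x / gradFun u x := by
  have hv0 := (v_pos hsp x).ne'
  have he0 := (e_pos u x).ne'
  have hes := es_eq hsp x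
  rw [lap_eq hsm hsp x rfl rfl rfl rfl rfl rfl rfl rfl rfl, gradH_eq hsp,
    pH_eq (N := 0) hsm hsp x rfl rfl rfl rfl rfl rfl rfl rfl,
    normA2_eq hsm hsp x rfl rfl rfl rfl rfl rfl rfl, At2_eq hsp x rfl rfl rfl rfl rfl,
    gradSq_eq hsm hsp x rfl rfl rfl rfl rfl, mcH_eq hsp]
  dsimp only
  generalize gradFun u x = v at *
  generalize eF u x = e at *
  generalize sF u x = s at *
  generalize QF u x = Q at *
  generalize RF u x = R at *
  generalize NF u x = N at *
  generalize LF u x = L at *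
  generalize alF u x = al at *
  generalize beF u x = be at *
  have hs : s = (1 - (v ^ 2)⁻¹) * e⁻¹ := by
    field_simp at hes ⊢
    linarith
  subst hs
  field_simp
  ring
end
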